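/- arXiv:2110.05914 — 4 statements merged into one kernel-verified Lean document; each statement's English description precedes it below -/
import Mathlib

section
/- Let d ≥ 1 and let ε_n → 0. For each n let f^{ε_n} ≥ 0 and E^{ε_n} be a weak solution of the rescaled Vlasov–Poisson system such that ‖f^{ε_n}(t)‖_{L^1(Q)} + ‖f^{ε_n}(t)‖_{L^∞(Q)} ≤ C_0 for all t ≥ 0, ∫_Q |v|² f^{ε_n}(t,x,v) dx dv ≤ K_0 for all t ≥ 0, and ‖E^{ε_n}‖_{L^∞(ℝ^+;L²(𝕋^d))} ≤ K_0/√{ε_n}, with constants C_0, K_0 independent of n. Then there exist a subsequence and a function f = f(t,v) ∈ L^∞(ℝ^+; L^1 ∩ L^∞(ℝ^d)), independent of x, such that along the subsequence f^{ε_n} → f in L^∞(ℝ^+; L^∞(Q)) weak-∗ and ⨍ f^{ε_n} dx → f in L^∞(ℝ^+; L^∞(ℝ^d)) weak-∗. -/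
open MeasureTheory Real Filter Topology ENNReal

noncomputable section

instance fact_two_pi_pos : Fact (0 < 2 * Real.pi) := ⟨by positivity⟩

/-- The `d`-dimensional torus `𝕋^d = (ℝ/2πℤ)^d`. -/
abbrev Torus (d : ℕ) := Fin d → AddCircle (2 * Real.pi)

/-- The velocity space `ℝ^d`. -/
abbrev Vel (d : ℕ) := EuclideanSpace ℝ (Fin d)

/-- The phase space `Q = 𝕋^d × ℝ^d`. -/
abbrev Phase (d : ℕ) := Torus d × Vel d

/-- Canonical projection `ℝ^d → 𝕋^d`. -/
def proj (d : ℕ) (y : Fin d → ℝ) : Torus d := fun i => (y i : AddCircle (2 * Real.pi))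

/-- Smooth functions on the torus, i.e. functions with a smooth periodic lift. -/
def SmoothOnTorus (d : ℕ) (χ : Torus d → ℝ) : Prop :=
  ContDiff ℝ (⊤ : ℕ∞) fun y : Fin d → ℝ => χ (proj d y)

/-- Directional derivative on the torus of `χ` at `x` in the direction `w ∈ ℝ^d`. -/
def dirDerivT (d : ℕ) (χ : Torus d → ℝ) (x : Torus d) (w : Fin d → ℝ) : ℝ :=
  deriv (fun t : ℝ => χ (x + proj d (fun i => t * w i))) 0

/-- Test functions `φ ∈ C_c^∞((0,∞) × Q)`: compactly supported, vanishing for `t ≤ 0`, with a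
smooth periodic lift in the space variable. -/
structure IsTestPQ (d : ℕ) (φ : ℝ → Phase d → ℝ) : Prop where
  compact : HasCompactSupport fun p : ℝ × Phase d => φ p.1 p.2
  future : ∀ t ≤ (0 : ℝ), ∀ z, φ t z = 0
  smooth : ∃ ψ : ℝ × (Fin d → ℝ) × Vel d → ℝ, ContDiff ℝ (⊤ : ℕ∞) ψ ∧
    ∀ t y v, φ t (proj d y, v) = ψ (t, y, v)

/-- The weak formulation of the rescaled Vlasov equation
`∂_t f + ε⁻² v·∇_x f + ε⁻¹ E·∇_v f = 0` on `ℝ^+ × Q`. -/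
def WeakVlasov (d : ℕ) (ε : ℝ) (f : ℝ → Phase d → ℝ) (E : ℝ → Torus d → Vel d) : Prop :=
  ∀ φ : ℝ → Phase d → ℝ, IsTestPQ d φ →
    (∫ t in Set.Ioi (0 : ℝ), ∫ z : Phase d, f t z *
      (deriv (fun s => φ s z) t
        + (ε ^ 2)⁻¹ * dirDerivT d (fun x => φ t (x, z.2)) z.1 (fun i => z.2 i)
        + ε⁻¹ * deriv (fun s : ℝ => φ t (z.1, z.2 + s • E t z.1)) 0)) = 0

/-- The weak formulation of the Poisson equation: `∇_x·E = ρ - 1` and `E = -∇_x Φ`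
distributionally on the torus, for every time `t ≥ 0`. -/
def WeakPoisson (d : ℕ) (f : ℝ → Phase d → ℝ) (E : ℝ → Torus d → Vel d)
    (Φ : ℝ → Torus d → ℝ) : Prop :=
  ∀ t : ℝ, 0 ≤ t →
    (∀ χ : Torus d → ℝ, SmoothOnTorus d χ →
      (∫ x : Torus d, ∑ i, E t x i * dirDerivT d χ x (Pi.single i 1))
        = -∫ x : Torus d, ((∫ v : Vel d, f t (x, v)) - 1) * χ x) ∧
    (∀ χ : Torus d → ℝ, SmoothOnTorus d χ → ∀ i : Fin d,
      (∫ x : Torus d, E t x i * χ x) = ∫ x : Torus d, Φ t x * dirDerivT d χ x (Pi.single i 1))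

/-- Weak solutions of the rescaled Vlasov–Poisson system, with the zero-mean electrostatic
condition and the global neutrality condition. -/
structure IsWeakSolVP (d : ℕ) (ε : ℝ) (f : ℝ → Phase d → ℝ) (E : ℝ → Torus d → Vel d)
    (Φ : ℝ → Torus d → ℝ) : Prop where
  fmeas : Measurable fun p : ℝ × Phase d => f p.1 p.2
  Emeas : Measurable fun p : ℝ × Torus d => E p.1 p.2
  nonneg : ∀ t z, 0 ≤ f t z
  vlasov : WeakVlasov d ε f E
  poisson : WeakPoisson d f E Φ
  zeroMean : ∀ t, 0 ≤ t → (∫ x : Torus d, E t x) = 0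
  neutral : ∀ t, 0 ≤ t → ((2 * Real.pi) ^ d)⁻¹ * (∫ z : Phase d, f t z) = 1

theorem exists_subseq_tendsto_inner {H : Type*} [NormedAddCommGroup H] [InnerProductSpace ℝ H]
    [CompleteSpace H] [TopologicalSpace.SeparableSpace H] (x : ℕ → H) (R : ℝ)
    (hx : ∀ n, ‖x n‖ ≤ R) :
    ∃ φ : ℕ → ℕ, StrictMono φ ∧ ∃ y : H, ∀ z : H,
      Tendsto (fun n => inner ℝ (x (φ n)) z) atTop (𝓝 (inner ℝ y z)) := by
  have hmem : ∀ n, StrongDual.toWeakDual (InnerProductSpace.toDual ℝ H (x n)) ∈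
      WeakDual.toStrongDual ⁻¹' Metric.closedBall (0 : StrongDual ℝ H) R := fun n => by
    simpa using! hx n
  obtain ⟨ℓ, -, φ, hφ, hlim⟩ := WeakDual.isSeqCompact_closedBall ℝ H 0 R hmem
  refine ⟨φ, hφ, (InnerProductSpace.toDual ℝ H).symm (WeakDual.toStrongDual ℓ), fun z => ?_⟩
  rw [InnerProductSpace.toDual_symm_apply]
  exact ((WeakDual.eval_continuous z).tendsto ℓ).comp hlim

theorem integrable_mul_of_bounds {α : Type*} [MeasurableSpace α] {μ : Measure α} {g u : α → ℝ}
    {C : ℝ} (hm : AEStronglyMeasurable g μ) (h0 : ∀ x, 0 ≤ g x) (hC : ∀ x, g x ≤ C)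
    (hu : Integrable u μ) : Integrable (fun x => g x * u x) μ :=
  hu.bdd_mul hm (Eventually.of_forall fun x => by
    rw [Real.norm_of_nonneg (h0 x)]; exact hC x)

theorem exists_subseq_weakStar_of_isFiniteMeasure {α : Type*} [MeasurableSpace α]
    [MeasurableSpace.CountablyGenerated α] (μ : Measure α) [IsFiniteMeasure μ]
    (g : ℕ → α → ℝ) (C : ℝ) (hC0 : 0 ≤ C) (hm : ∀ n, Measurable (g n)) (h0 : ∀ n x, 0 ≤ g n x)
    (hC : ∀ n x, g n x ≤ C) :
    ∃ φ : ℕ → ℕ, StrictMono φ ∧ ∃ F : α → ℝ, Measurable F ∧ (∀ x, 0 ≤ F x) ∧ (∀ x, F x ≤ C) ∧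
      ∀ u : α → ℝ, Integrable u μ →
        Tendsto (fun n => ∫ x, g (φ n) x * u x ∂μ) atTop (𝓝 (∫ x, F x * u x ∂μ)) := by
  have hL : ∀ n, MemLp (g n) 2 μ := fun n =>
    MemLp.of_bound (hm n).aestronglyMeasurable C (Eventually.of_forall fun x => by
      rw [Real.norm_of_nonneg (h0 n x)]; exact hC n x)
  have hI : ∀ n, Integrable (g n) μ := fun n => (hL n).integrable (by norm_num)
  have : Fact ((2 : ℝ≥0∞) ≠ ⊤) := ⟨by norm_num⟩
  obtain ⟨φ, hφ, y, hy⟩ := exists_subseq_tendsto_inner (fun n => (hL n).toLp (g n))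
    ((μ.real Set.univ) ^ (2 : ℝ≥0∞).toReal⁻¹ * C) (fun n => by
      refine Lp.norm_le_of_ae_bound hC0 ?_
      filter_upwards [(hL n).coeFn_toLp] with x hx
      rw [hx, Real.norm_of_nonneg (h0 n x)]
      exact hC n x)
  have hyI : Integrable y μ := (Lp.memLp y).integrable (by norm_num)
  have hset : ∀ s, MeasurableSet s →
      Tendsto (fun n => ∫ x in s, g (φ n) x ∂μ) atTop (𝓝 (∫ x in s, y x ∂μ)) := by
    intro s hs
    have h1 := hy (indicatorConstLp 2 hs (measure_ne_top μ s) (1 : ℝ))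
    have h2 : ∀ a : Lp ℝ 2 μ, inner ℝ a (indicatorConstLp 2 hs (measure_ne_top μ s) (1 : ℝ))
        = ∫ x in s, a x ∂μ := fun a => by
      rw [real_inner_comm, L2.inner_indicatorConstLp_one]
    simp_rw [h2] at h1
    refine h1.congr fun n => setIntegral_congr_ae hs ?_
    filter_upwards [(hL (φ n)).coeFn_toLp] with x hx _ using hx
  have hy0 : ∀ᵐ x ∂μ, 0 ≤ y x :=
    ae_nonneg_of_forall_setIntegral_nonneg hyI fun s hs _ =>
      ge_of_tendsto' (hset s hs) fun n => integral_nonneg fun x => h0 _ x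
  have hyC : ∀ᵐ x ∂μ, y x ≤ C :=
    ae_le_of_forall_setIntegral_le hyI (integrable_const C) fun s hs _ =>
      le_of_tendsto' (hset s hs) fun n =>
        integral_mono (hI _).integrableOn (integrable_const C) fun x => hC _ x
  obtain ⟨F, hF, hFy⟩ : ∃ F, Measurable F ∧ y =ᵐ[μ] F :=
    ⟨_, (Lp.aestronglyMeasurable y).aemeasurable.measurable_mk,
      (Lp.aestronglyMeasurable y).aemeasurable.ae_eq_mk⟩
  refine ⟨φ, hφ, fun x => max 0 (min (F x) C), by fun_prop, fun x => le_max_left _ _,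
    fun x => max_le hC0 (min_le_right _ _), ?_⟩
  set G : α → ℝ := fun x => max 0 (min (F x) C) with hG
  have hGm : Measurable G := by fun_prop
  have hG0 : ∀ x, 0 ≤ G x := fun x => le_max_left _ _
  have hGC : ∀ x, G x ≤ C := fun x => max_le hC0 (min_le_right _ _)
  have hGy : ∀ᵐ x ∂μ, y x = G x := by
    filter_upwards [hFy, hy0, hyC] with x h1 h2 h3
    simp only [hG, ← h1, min_eq_left h3, max_eq_right h2]
  have hint : ∀ {k u : α → ℝ}, Measurable k → (∀ x, 0 ≤ k x) → (∀ x, k x ≤ C) →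
      Integrable u μ → Integrable (fun x => k x * u x) μ := fun hk hk0 hkC hu =>
    integrable_mul_of_bounds hk.aestronglyMeasurable hk0 hkC hu
  refine fun u hu => Integrable.induction (μ := μ) (fun u : α → ℝ =>
    Tendsto (fun n => ∫ x, g (φ n) x * u x ∂μ) atTop (𝓝 (∫ x, G x * u x ∂μ)))
    ?_ ?_ ?_ ?_ hu
  · intro c s hs hfin
    have key : ∀ k : α → ℝ, ∫ x, k x * s.indicator (fun _ => c) x ∂μ
        = (∫ x in s, k x ∂μ) * c := fun k => by
      rw [← integral_mul_const, ← integral_indicator hs]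
      congr 1 with x
      by_cases hx : x ∈ s <;> simp [hx]
    simp_rw [key]
    rw [← setIntegral_congr_ae (μ := μ) hs (hGy.mono fun x hx _ => hx)]
    exact (hset s hs).mul_const c
  · intro p q _ hf hg hf' hg'
    simp only [Pi.add_apply, mul_add]
    rw [integral_add (hint hGm hG0 hGC hf) (hint hGm hG0 hGC hg)]
    refine (hf'.add hg').congr fun n => ?_
    rw [integral_add (hint (hm _) (h0 _) (hC _) hf) (hint (hm _) (h0 _) (hC _) hg)]
  · refine isClosed_of_closure_subset fun v hv => ?_
    simp only [Set.mem_ofPred_eq]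
    rw [Metric.tendsto_atTop]
    intro δ hδ
    obtain ⟨w, hw, hvw⟩ := Metric.mem_closure_iff.1 hv (δ / (3 * (C + 1))) (by positivity)
    have hb : ∀ k : α → ℝ, Measurable k → (∀ x, 0 ≤ k x) → (∀ x, k x ≤ C) →
        |∫ x, k x * v x ∂μ - ∫ x, k x * w x ∂μ| < δ / 3 := by
      intro k hk hk0 hkC
      rw [← integral_sub (hint hk hk0 hkC (L1.integrable_coeFn v))
        (hint hk hk0 hkC (L1.integrable_coeFn w))]
      calc |∫ x, (k x * v x - k x * w x) ∂μ| ≤ ∫ x, C * ‖v x - w x‖ ∂μ := by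
            refine norm_integral_le_of_norm_le (G := ℝ) ?_ (Eventually.of_forall fun x => ?_)
            · exact (((L1.integrable_coeFn v).sub (L1.integrable_coeFn w)).norm).const_mul C
            · rw [← mul_sub, norm_mul, Real.norm_of_nonneg (hk0 x)]
              exact mul_le_mul_of_nonneg_right (hkC x) (norm_nonneg _)
        _ = C * dist v w := by rw [integral_const_mul, dist_eq_norm, L1.norm_eq_integral_norm]
                               congr 1
                               refine integral_congr_ae ?_
                               filter_upwards [Lp.coeFn_sub v w] with x hx
                               rw [hx]; rfl
        _ ≤ (C + 1) * dist v w := by gcongr; linarith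
        _ < (C + 1) * (δ / (3 * (C + 1))) := by gcongr
        _ = δ / 3 := by field_simp
    obtain ⟨N, hN⟩ := Metric.tendsto_atTop.1 hw (δ / 3) (by positivity)
    refine ⟨N, fun n hn => ?_⟩
    have e1 := hb _ (hm (φ n)) (h0 _) (hC _)
    have e2 := hb _ hGm hG0 hGC
    have e3 := hN n hn
    rw [Real.dist_eq] at *
    rw [abs_lt] at *
    constructor <;> linarith [e1.1, e1.2, e2.1, e2.2, e3.1, e3.2]
  · intro p q hfg _ hf
    have key : ∀ k : α → ℝ, ∫ x, k x * p x ∂μ = ∫ x, k x * q x ∂μ := fun k =>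
      integral_congr_ae (hfg.mono fun x hx => by simp only [hx])
    simpa only [key] using hf

theorem exists_subseq_weakStar {α : Type*} [MeasurableSpace α]
    [MeasurableSpace.CountablyGenerated α] (μ : Measure α) [SigmaFinite μ]
    (g : ℕ → α → ℝ) (C : ℝ) (hC0 : 0 ≤ C) (hm : ∀ n, Measurable (g n)) (h0 : ∀ n x, 0 ≤ g n x)
    (hC : ∀ n x, g n x ≤ C) :
    ∃ φ : ℕ → ℕ, StrictMono φ ∧ ∃ F : α → ℝ, Measurable F ∧ (∀ x, 0 ≤ F x) ∧ (∀ x, F x ≤ C) ∧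
      ∀ u : α → ℝ, Integrable u μ →
        Tendsto (fun n => ∫ x, g (φ n) x * u x ∂μ) atTop (𝓝 (∫ x, F x * u x ∂μ)) := by
  obtain ⟨w, hw0, hwm, hw1⟩ := exists_pos_lintegral_lt_of_sigmaFinite μ one_ne_zero
  have : IsFiniteMeasure (μ.withDensity fun x => (w x : ℝ≥0∞)) :=
    isFiniteMeasure_withDensity (hw1.trans one_lt_top).ne
  obtain ⟨φ, hφ, F, hF, hF0, hFC, hlim⟩ := exists_subseq_weakStar_of_isFiniteMeasure
    (μ.withDensity fun x => (w x : ℝ≥0∞)) g C hC0 hm h0 hC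
  refine ⟨φ, hφ, F, hF, hF0, hFC, fun u hu => ?_⟩
  have hcancel : ∀ (k : α → ℝ) x, w x • (k x * ((w x : ℝ)⁻¹ * u x)) = k x * u x := fun k x => by
    have : (w x : ℝ) ≠ 0 := by exact_mod_cast (hw0 x).ne'
    rw [NNReal.smul_def, smul_eq_mul]
    field_simp
  have key : ∀ k : α → ℝ,
      ∫ x, k x * ((w x : ℝ)⁻¹ * u x) ∂(μ.withDensity fun x => (w x : ℝ≥0∞))
        = ∫ x, k x * u x ∂μ := fun k => by
    rw [integral_withDensity_eq_integral_smul hwm]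
    simp_rw [hcancel]
  have := hlim (fun x => (w x : ℝ)⁻¹ * u x) (by
    rw [integrable_withDensity_iff_integrable_smul hwm]
    refine hu.congr (Eventually.of_forall fun x => ?_)
    have := hcancel (fun _ => 1) x
    simp only [one_mul] at this
    exact this.symm)
  simpa only [key] using this

/-- The character `x ↦ exp (i k·x)` of the torus. -/
def torusChar {d : ℕ} (k : Fin d → ℤ) (x : Torus d) : ℂ := ∏ i, fourier (k i) (x i)

theorem continuous_torusChar {d : ℕ} (k : Fin d → ℤ) : Continuous (torusChar k) :=
  continuous_finsetProd _ fun i _ => (fourier (k i)).continuous.comp (continuous_apply i)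

theorem norm_torusChar {d : ℕ} (k : Fin d → ℤ) (x : Torus d) : ‖torusChar k x‖ = 1 := by
  simp only [torusChar, norm_prod, fourier_apply]
  exact Finset.prod_eq_one fun i _ => Circle.norm_coe _

theorem torusChar_proj {d : ℕ} (k : Fin d → ℤ) (y : Fin d → ℝ) :
    torusChar k (proj d y) = Complex.exp ((∑ i, (k i : ℝ) * y i : ℝ) * Complex.I) := by
  have h : (Real.pi : ℂ) ≠ 0 := by exact_mod_cast Real.pi_ne_zero
  simp only [torusChar, proj, fourier_coe_apply, ← Complex.exp_sum]
  congr 1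
  push_cast
  rw [Finset.sum_mul]
  refine Finset.sum_congr rfl fun i _ => ?_
  field_simp

theorem proj_surjective (d : ℕ) : Function.Surjective (proj d) := fun x =>
  ⟨fun i => (QuotientAddGroup.mk_surjective (x i)).choose,
    funext fun i => (QuotientAddGroup.mk_surjective (x i)).choose_spec⟩

theorem volume_real_torus (d : ℕ) : (volume : Measure (Torus d)).real Set.univ
    = (2 * Real.pi) ^ d := by
  rw [Measure.real, volume_pi, Measure.pi_univ]
  simp [AddCircle.measure_univ, ENNReal.toReal_ofReal Real.pi_pos.le]

theorem integral_torusChar {d : ℕ} {k : Fin d → ℤ} (hk : k ≠ 0) :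
    ∫ x : Torus d, torusChar k x = 0 := by
  obtain ⟨i, hi⟩ := Function.ne_iff.1 hk
  have h0 : ∫ x : AddCircle (2 * Real.pi), fourier (k i) x = 0 :=
    integral_eq_zero_of_add_right_eq_neg
      (fourier_add_half_inv_index hi (fact_two_pi_pos.out))
  simp only [torusChar]
  rw [volume_pi, integral_fintype_prod_eq_prod]
  exact Finset.prod_eq_zero (Finset.mem_univ i) h0

/-- The rescaling homeomorphism from the torus of period `2π` to the unit torus. -/
def torusRescale (d : ℕ) : Torus d ≃ₜ UnitAddTorus (Fin d) :=
  Homeomorph.piCongrRight fun _ =>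
    AddCircle.homeomorphAddCircle (2 * Real.pi) 1 (by positivity) one_ne_zero

theorem mFourier_torusRescale {d : ℕ} (k : Fin d → ℤ) (x : Torus d) :
    UnitAddTorus.mFourier k (torusRescale d x) = torusChar k x := by
  obtain ⟨y, rfl⟩ := proj_surjective d x
  have h : (Real.pi : ℂ) ≠ 0 := by exact_mod_cast Real.pi_ne_zero
  simp only [torusChar, UnitAddTorus.mFourier, torusRescale, ContinuousMap.coe_mk, proj,
    Homeomorph.piCongrRight_apply, AddCircle.homeomorphAddCircle_apply_mk, fourier_coe_apply]
  refine Finset.prod_congr rfl fun i _ => ?_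
  congr 1
  push_cast
  field_simp

theorem integral_mul_eq_zero_of_torusChar {d : ℕ} {G : Torus d → ℝ} (hG : Integrable G)
    (h : ∀ k, ∫ x, (G x : ℂ) * torusChar k x = 0) (χ : C(Torus d, ℝ)) :
    ∫ x, G x * χ x = 0 := by
  have hint : ∀ ψ : C(UnitAddTorus (Fin d), ℂ),
      Integrable fun x : Torus d => (G x : ℂ) * ψ (torusRescale d x) := fun ψ =>
    hG.ofReal.mul_bdd (c := ‖ψ‖) (by fun_prop)
      (Eventually.of_forall fun x => ψ.norm_coe_le_norm _)
  let L : C(UnitAddTorus (Fin d), ℂ) →L[ℂ] ℂ := LinearMap.mkContinuous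
    { toFun := fun ψ => ∫ x : Torus d, (G x : ℂ) * ψ (torusRescale d x)
      map_add' := fun ψ₁ ψ₂ => by
        simp only [ContinuousMap.add_apply, mul_add]
        exact integral_add (hint ψ₁) (hint ψ₂)
      map_smul' := fun c ψ => by
        simp only [ContinuousMap.smul_apply, smul_eq_mul, mul_left_comm _ c, RingHom.id_apply]
        exact integral_const_mul c _ }
    (∫ x, ‖G x‖) fun ψ => by
      rw [← integral_mul_const]
      refine norm_integral_le_of_norm_le (hG.norm.mul_const _) (Eventually.of_forall fun x => ?_)
      rw [norm_mul, Complex.norm_real]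
      gcongr
      exact ψ.norm_coe_le_norm _
  have hL : L = 0 := by
    refine ContinuousLinearMap.ext_on (s := Set.range UnitAddTorus.mFourier) ?_ ?_
    · rw [Submodule.dense_iff_topologicalClosure_eq_top]
      exact UnitAddTorus.span_mFourier_closure_eq_top
    · rintro _ ⟨k, rfl⟩
      change ∫ x : Torus d, (G x : ℂ) * UnitAddTorus.mFourier k (torusRescale d x) = 0
      simpa only [mFourier_torusRescale] using h k
  have h2 : ∫ x : Torus d, (G x : ℂ) * ((χ ((torusRescale d).symm (torusRescale d x)) : ℝ) : ℂ) = 0 :=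
    congrArg (fun M : C(UnitAddTorus (Fin d), ℂ) →L[ℂ] ℂ =>
      M ⟨fun z => (χ ((torusRescale d).symm z) : ℂ), by fun_prop⟩) hL
  simp only [Homeomorph.symm_apply_apply, ← Complex.ofReal_mul] at h2
  rw [integral_complex_ofReal] at h2
  exact_mod_cast h2

theorem ae_eq_average_of_torusChar {d : ℕ} {F : Torus d → ℝ} {C : ℝ} (hF : Measurable F)
    (h0 : ∀ x, 0 ≤ F x) (hC : ∀ x, F x ≤ C)
    (h : ∀ k : Fin d → ℤ, k ≠ 0 → ∫ x, (F x : ℂ) * torusChar k x = 0) :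
    ∀ᵐ x, F x = ((2 * Real.pi) ^ d)⁻¹ * ∫ x, F x := by
  set c := ((2 * Real.pi) ^ d)⁻¹ * ∫ x, F x with hc
  have hc0 : 0 ≤ c := by
    have : 0 ≤ ∫ x, F x := integral_nonneg h0
    positivity
  have hFI : Integrable F := Integrable.of_bound hF.aestronglyMeasurable C
    (Eventually.of_forall fun x => by rw [Real.norm_of_nonneg (h0 x)]; exact hC x)
  have hbdd : ∀ χ : C(Torus d, ℝ), ∀ᵐ x ∂(volume : Measure (Torus d)), ‖χ x‖ ≤ ‖χ‖ := fun χ =>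
    Eventually.of_forall fun x => χ.norm_coe_le_norm x
  have key := integral_mul_eq_zero_of_torusChar (G := fun x => F x - c)
    (hFI.sub (integrable_const c)) (fun k => by
      have hk : Integrable (torusChar k) := Integrable.of_bound
        (continuous_torusChar k).aestronglyMeasurable 1
        (Eventually.of_forall fun x => (norm_torusChar k x).le)
      push_cast
      simp only [sub_mul]
      rw [integral_sub, integral_const_mul]
      · by_cases hk0 : k = 0
        · subst hk0
          have : ∀ x : Torus d, torusChar 0 x = 1 := fun x => by simp [torusChar]
          simp only [this, mul_one]
          rw [integral_complex_ofReal, integral_const, volume_real_torus, hc]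
          have : (Real.pi : ℂ) ≠ 0 := by exact_mod_cast Real.pi_ne_zero
          push_cast
          simp only [Complex.real_smul]
          push_cast
          field_simp
          ring
        · rw [h k hk0, integral_torusChar hk0]; simp
      · exact hFI.ofReal.mul_bdd (c := 1) (continuous_torusChar k).aestronglyMeasurable
          (Eventually.of_forall fun x => (norm_torusChar k x).le)
      · exact hk.const_mul _)
  have hmeas : (volume : Measure (Torus d)).withDensity (fun x => ENNReal.ofReal (F x))
      = volume.withDensity (fun _ => ENNReal.ofReal c) := by
    have : IsFiniteMeasure ((volume : Measure (Torus d)).withDensity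
        (fun x => ENNReal.ofReal (F x))) := isFiniteMeasure_withDensity_ofReal hFI.2
    have : IsFiniteMeasure ((volume : Measure (Torus d)).withDensity
        (fun _ => ENNReal.ofReal c)) := isFiniteMeasure_withDensity_ofReal (integrable_const c).2
    refine ext_of_forall_integral_eq_of_IsFiniteMeasure fun χ => ?_
    rw [integral_withDensity_eq_integral_toReal_smul (by fun_prop) (by simp),
      integral_withDensity_eq_integral_toReal_smul (by fun_prop) (by simp)]
    simp only [ENNReal.toReal_ofReal (h0 _), ENNReal.toReal_ofReal hc0, smul_eq_mul]
    have := key χ.toContinuousMap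
    simp only [sub_mul] at this
    rw [integral_sub (hFI.mul_bdd (by fun_prop) (hbdd _))
      ((integrable_const c).mul_bdd (by fun_prop) (hbdd _))] at this
    exact sub_eq_zero.1 this
  rw [withDensity_eq_iff_of_sigmaFinite (by fun_prop) (by fun_prop)] at hmeas
  filter_upwards [hmeas] with x hx
  exact (ENNReal.ofReal_eq_ofReal_iff (h0 x) hc0).1 hx

/-- Lebesgue measure on `(0,∞) × Q`. -/
abbrev halfMeasure (d : ℕ) : Measure (ℝ × Phase d) :=
  (volume.restrict (Set.Ioi (0 : ℝ))).prod volume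

/-- Restriction of a function of time and space to `t ≤ T`, `‖v‖ ≤ R`. -/
def cutoff {d : ℕ} (T R : ℝ) (e : ℝ → Torus d → ℝ) : ℝ × Phase d → ℝ :=
  Set.indicator {p | p.1 ≤ T ∧ ‖p.2.2‖ ≤ R} fun p => e p.1 p.2.1

theorem integrable_cutoff (d : ℕ) (T R : ℝ) : ∃ D : ℝ, 0 ≤ D ∧
    ∀ (e : ℝ → Torus d → ℝ) (A : ℝ), 0 ≤ A → (Measurable fun p : ℝ × Torus d => e p.1 p.2) →
      (∀ t > 0, ∫⁻ x, ‖e t x‖ₑ ≤ ENNReal.ofReal A) →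
      Integrable (cutoff T R e) (halfMeasure d) ∧
        ∫ p, ‖cutoff T R e p‖ ∂(halfMeasure d) ≤ D * A := by
  set b : ℝ≥0∞ := volume (Metric.closedBall (0 : Vel d) R) with hb
  have hbt : b ≠ ⊤ := measure_closedBall_lt_top.ne
  refine ⟨(b * ENNReal.ofReal T).toReal, ENNReal.toReal_nonneg, fun e A hA hem he => ?_⟩
  have hSm : MeasurableSet {p : ℝ × Phase d | p.1 ≤ T ∧ ‖p.2.2‖ ≤ R} := by measurability
  have hWm : Measurable (cutoff T R e) :=
    (hem.comp (by fun_prop : Measurable fun p : ℝ × Phase d => (p.1, p.2.1))).indicator hSm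
  have hbound : ∫⁻ p, ‖cutoff T R e p‖ₑ ∂(halfMeasure d)
      ≤ b * ENNReal.ofReal T * ENNReal.ofReal A := by
    rw [lintegral_prod _ hWm.enorm.aemeasurable]
    calc ∫⁻ t in Set.Ioi (0 : ℝ), ∫⁻ z, ‖cutoff T R e (t, z)‖ₑ
        ≤ ∫⁻ t in Set.Ioi (0 : ℝ), (Set.Iic T).indicator (fun _ => ENNReal.ofReal A * b) t := by
          refine setLIntegral_mono' measurableSet_Ioi fun t ht => ?_
          by_cases htT : t ≤ T
          · have h1 : ∀ z : Phase d, ‖cutoff T R e (t, z)‖ₑ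
                = ‖e t z.1‖ₑ * (Metric.closedBall (0 : Vel d) R).indicator 1 z.2 := fun z => by
              by_cases hz : ‖z.2‖ ≤ R
              · simp [cutoff, htT, hz]
              · simp [cutoff, hz]
            simp_rw [h1]
            rw [Measure.volume_eq_prod, lintegral_prod_mul (f := fun x => ‖e t x‖ₑ)
              (hem.comp (by fun_prop : Measurable fun x : Torus d => (t, x))).enorm.aemeasurable
              ((measurable_one.indicator Metric.isClosed_closedBall.measurableSet).aemeasurable),
              lintegral_indicator_one Metric.isClosed_closedBall.measurableSet]
            simp only [Set.indicator, Set.mem_Iic, htT, if_true]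
            gcongr
            exact he t ht
          · have h1 : ∀ z : Phase d, ‖cutoff T R e (t, z)‖ₑ = 0 := fun z => by
              simp [cutoff, htT]
            simp [h1]
      _ = b * ENNReal.ofReal T * ENNReal.ofReal A := by
          rw [lintegral_indicator measurableSet_Iic, setLIntegral_const,
            Measure.restrict_apply measurableSet_Iic, Set.Iic_inter_Ioi, Real.volume_Ioc, sub_zero]
          ring
  have hlt : b * ENNReal.ofReal T * ENNReal.ofReal A < ⊤ := by finiteness
  refine ⟨⟨hWm.aestronglyMeasurable, hbound.trans_lt hlt⟩, ?_⟩
  rw [integral_norm_eq_lintegral_enorm hWm.aestronglyMeasurable]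
  calc _ ≤ (b * ENNReal.ofReal T * ENNReal.ofReal A).toReal := ENNReal.toReal_mono hlt.ne hbound
    _ = _ := by rw [ENNReal.toReal_mul, ENNReal.toReal_ofReal hA]

/-- The linear form `v ↦ k·v`. -/
def waveDot {d : ℕ} (k : Fin d → ℤ) (v : Fin d → ℝ) : ℝ := ∑ i, (k i : ℝ) * v i

theorem torusChar_add_proj {d : ℕ} (k : Fin d → ℤ) (x : Torus d) (w : Fin d → ℝ) :
    torusChar k (x + proj d w) = torusChar k x * Complex.exp ((waveDot k w : ℝ) * Complex.I) := by
  obtain ⟨y, rfl⟩ := proj_surjective d x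
  have : proj d y + proj d w = proj d (y + w) := by
    funext i; simp [proj]
  rw [this, torusChar_proj, torusChar_proj, ← Complex.exp_add]
  congr 1
  simp only [waveDot, Pi.add_apply, mul_add, Finset.sum_add_distrib]
  push_cast
  ring

theorem dirDerivT_torusChar {d : ℕ} (k : Fin d → ℤ) (θ : ℝ) (c : ℂ) (x : Torus d)
    (w : Fin d → ℝ) :
    dirDerivT d (fun x => θ * (c * torusChar k x).re) x w
      = θ * waveDot k w * (c * Complex.I * torusChar k x).re := by
  have h1 : ∀ t : ℝ, (waveDot k fun i => t * w i) = t * waveDot k w := fun t => by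
    simp only [waveDot, Finset.mul_sum]
    exact Finset.sum_congr rfl fun i _ => by ring
  unfold dirDerivT
  simp only [torusChar_add_proj, h1]
  have h2 : HasDerivAt (fun t : ℝ => c * (torusChar k x *
      Complex.exp (((t * waveDot k w : ℝ) : ℂ) * Complex.I)))
      (c * (torusChar k x * (Complex.exp (((0 * waveDot k w : ℝ) : ℂ) * Complex.I) *
        (((1 * waveDot k w : ℝ) : ℂ) * Complex.I)))) 0 :=
    (((((hasDerivAt_id (0 : ℝ)).mul_const (waveDot k w)).ofReal_comp.mul_const
      Complex.I).cexp).const_mul _).const_mul c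
  have h3 := (Complex.reCLM.hasFDerivAt.comp_hasDerivAt 0 h2).const_mul θ
  refine h3.deriv.trans ?_
  have : c * (torusChar k x * (Complex.exp (((0 * waveDot k w : ℝ) : ℂ) * Complex.I) *
        (((1 * waveDot k w : ℝ) : ℂ) * Complex.I)))
      = (waveDot k w : ℂ) * (c * Complex.I * torusChar k x) := by
    rw [zero_mul, Complex.ofReal_zero, zero_mul, Complex.exp_zero, one_mul, one_mul]
    ring
  rw [this, Complex.reCLM_apply, Complex.re_ofReal_mul, mul_assoc θ]

theorem abs_re_torusChar_le {d : ℕ} (k : Fin d → ℤ) {c : ℂ} (hc : ‖c‖ = 1) (x : Torus d) :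
    |(c * torusChar k x).re| ≤ 1 :=
  (Complex.abs_re_le_norm _).trans (by rw [norm_mul, hc, norm_torusChar, one_mul])

theorem hasCompactSupport_mul_torus {d : ℕ} {θ : ℝ × Vel d → ℝ} (hθc : HasCompactSupport θ)
    (s : Torus d → ℝ) :
    HasCompactSupport fun p : ℝ × Phase d => θ (p.1, p.2.2) * s p.2.1 := by
  refine HasCompactSupport.intro
    ((hθc.isCompact.prod (isCompact_univ (X := Torus d))).image
      (f := fun q : (ℝ × Vel d) × Torus d => (q.1.1, (q.2, q.1.2))) (by fun_prop)) ?_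
  rintro ⟨t, x, v⟩ hp
  have : (t, v) ∉ tsupport θ := fun hmem => hp ⟨((t, v), x), ⟨hmem, Set.mem_univ _⟩, rfl⟩
  simp [image_eq_zero_of_notMem_tsupport this]

theorem continuous_re_torusChar {d : ℕ} (k : Fin d → ℤ) (c : ℂ) :
    Continuous fun x : Torus d => (c * torusChar k x).re :=
  Complex.continuous_re.comp (continuous_const.mul (continuous_torusChar k))

theorem integrable_mul_torusChar {d : ℕ} (k : Fin d → ℤ) (c : ℂ) {h : ℝ × Vel d → ℝ}
    (hh : Continuous h) (hc : HasCompactSupport h) :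
    Integrable (fun p : ℝ × Phase d => h (p.1, p.2.2) * (c * torusChar k p.2.1).re)
      (halfMeasure d) :=
  Continuous.integrable_of_hasCompactSupport
    ((hh.comp (by fun_prop)).mul ((continuous_re_torusChar k c).comp (by fun_prop)))
    (hasCompactSupport_mul_torus hc fun x => (c * torusChar k x).re)

theorem isTestPQ_mul_torusChar {d : ℕ} (k : Fin d → ℤ) (c : ℂ) {θ : ℝ × Vel d → ℝ}
    (hθ : ContDiff ℝ (⊤ : ℕ∞) θ) (hθc : HasCompactSupport θ)
    (hθ0 : ∀ p : ℝ × Vel d, p.1 ≤ 0 → θ p = 0) :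
    IsTestPQ d fun t z => θ (t, z.2) * (c * torusChar k z.1).re where
  compact := hasCompactSupport_mul_torus hθc fun x => (c * torusChar k x).re
  future t ht z := by simp [hθ0 (t, z.2) ht]
  smooth := by
    refine ⟨fun q => θ (q.1, q.2.2) * (c.re * Real.cos (∑ i, (k i : ℝ) * q.2.1 i)
      - c.im * Real.sin (∑ i, (k i : ℝ) * q.2.1 i)), by fun_prop, fun t y v => ?_⟩
    simp only [torusChar_proj, Complex.mul_re, Complex.exp_ofReal_mul_I_re,
      Complex.exp_ofReal_mul_I_im]

theorem iterated_integral_eq {d : ℕ} {f : ℝ → Phase d → ℝ} {g X : ℝ × Phase d → ℝ}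
    (hfg : ∀ᵐ t ∂(volume.restrict (Set.Ioi 0)), ∀ᵐ z, f t z = g (t, z))
    (hi : Integrable (fun p => g p * X p) (halfMeasure d)) :
    ∫ t in Set.Ioi (0 : ℝ), ∫ z, f t z * X (t, z) = ∫ p, g p * X p ∂(halfMeasure d) := by
  rw [integral_prod _ hi]
  refine integral_congr_ae ?_
  filter_upwards [hfg] with t ht
  refine integral_congr_ae ?_
  filter_upwards [ht] with z hz
  rw [hz]

theorem contDiff_waveDot {d : ℕ} (k : Fin d → ℤ) :
    ContDiff ℝ (⊤ : ℕ∞) fun v : Vel d => waveDot k fun i => v i := by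
  unfold waveDot
  fun_prop

theorem weakVlasov_mode_bound {d : ℕ} {k : Fin d → ℤ} {c : ℂ} (hc : ‖c‖ = 1)
    {h : ℝ × Vel d → ℝ} (hs : ContDiff ℝ (⊤ : ℕ∞) h) (hcs : HasCompactSupport h)
    (hsupp : tsupport h ⊆ {p | 0 < p.1 ∧ waveDot k (fun i => p.2 i) ≠ 0}) {C : ℝ} (hC : 0 ≤ C) :
    ∃ D : ℝ, ∀ (ε : ℝ) (f : ℝ → Phase d → ℝ) (E : ℝ → Torus d → Vel d) (A : ℝ)
      (g : ℝ × Phase d → ℝ), 0 < ε → 0 ≤ A → Measurable g → (∀ p, 0 ≤ g p) → (∀ p, g p ≤ C) →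
      (∀ t > 0, ∀ᵐ z, f t z = g (t, z)) → (Measurable fun p : ℝ × Torus d => E p.1 p.2) →
      (∀ t > 0, ∫⁻ x, ‖E t x‖ₑ ≤ ENNReal.ofReal A) → WeakVlasov d ε f E →
      |∫ p, g p * (h (p.1, p.2.2) * (c * Complex.I * torusChar k p.2.1).re) ∂(halfMeasure d)|
        ≤ D * (ε ^ 2 + ε * A) := by
  set θ : ℝ × Vel d → ℝ := fun p => h p * (waveDot k fun i => p.2 i)⁻¹ with hθdef
  have hθh : tsupport θ ⊆ tsupport h := tsupport_mul_subset_left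
  have hθs : ContDiff ℝ (⊤ : ℕ∞) θ := contDiff_iff_contDiffAt.2 fun p => by
    by_cases hp : p ∈ tsupport h
    · exact hs.contDiffAt.mul ((((contDiff_waveDot k).comp contDiff_snd).contDiffAt).inv
        (hsupp hp).2)
    · exact contDiffAt_const.congr_of_eventuallyEq
        (notMem_tsupport_iff_eventuallyEq.1 fun hmem => hp (hθh hmem))
  have hθc : HasCompactSupport θ := hcs.mul_right
  have hθ0 : ∀ p : ℝ × Vel d, p.1 ≤ 0 → θ p = 0 := fun p hp =>
    image_eq_zero_of_notMem_tsupport fun hmem => (hsupp (hθh hmem)).1.not_ge hp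
  have hθk : ∀ p : ℝ × Vel d, θ p * (waveDot k fun i => p.2 i) = h p := fun p => by
    by_cases hp : p ∈ tsupport h
    · simp only [hθdef]
      rw [mul_assoc, inv_mul_cancel₀ (hsupp hp).2, mul_one]
    · simp [hθdef, image_eq_zero_of_notMem_tsupport hp]
  have hD1 : Continuous (fderiv ℝ θ) := hθs.continuous_fderiv (by simp)
  obtain ⟨B, hB⟩ := hD1.bounded_above_of_compact_support (hθc.fderiv ℝ)
  have hB0 : 0 ≤ B := (norm_nonneg _).trans (hB 0)
  obtain ⟨R, hR⟩ := hθc.isCompact.isBounded.subset_closedBall (0 : ℝ × Vel d)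
  have hcut : ∀ p : ℝ × Vel d, ¬ (p.1 ≤ R ∧ ‖p.2‖ ≤ R) → fderiv ℝ θ p = 0 := fun p hp => by
    refine image_eq_zero_of_notMem_tsupport fun hmem => hp ?_
    have hn := hR (tsupport_fderiv_subset ℝ hmem)
    rw [mem_closedBall_zero_iff, Prod.norm_def, max_le_iff] at hn
    exact ⟨(le_abs_self _).trans hn.1, hn.2⟩
  obtain ⟨D, hD0, hD⟩ := integrable_cutoff d R R
  set V : ℝ := (volume : Measure (Torus d)).real Set.univ with hV
  refine ⟨C * B * D * (V + 1), fun ε f E A g hε hA hg hg0 hgC hfg hE hEA hw => ?_⟩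
  obtain ⟨hI1, hb1⟩ := hD (fun _ _ => 1) V measureReal_nonneg measurable_const fun t _ => by
    simp [hV, Measure.real, ENNReal.ofReal_toReal]
  obtain ⟨hI2, hb2⟩ := hD (fun t x => ‖E t x‖) A hA hE.norm fun t ht => by
    simpa using hEA t ht
  set s : Torus d → ℝ := fun x => (c * torusChar k x).re with hsdef
  set s' : Torus d → ℝ := fun x => (c * Complex.I * torusChar k x).re with hs'def
  have hsc : Continuous s := continuous_re_torusChar k c
  have hs1 : ∀ x, |s x| ≤ 1 := abs_re_torusChar_le k hc
  set a : ℝ × Phase d → ℝ := fun p => fderiv ℝ θ (p.1, p.2.2) (1, 0) * s p.2.1 with ha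
  set b : ℝ × Phase d → ℝ := fun p => fderiv ℝ θ (p.1, p.2.2) (0, E p.1 p.2.1) * s p.2.1 with hb
  set m : ℝ × Phase d → ℝ := fun p => h (p.1, p.2.2) * s' p.2.1 with hm
  have ham : Measurable a := by
    refine Measurable.mul ?_ (hsc.measurable.comp (by fun_prop))
    exact ((hD1.comp (by fun_prop : Continuous fun p : ℝ × Phase d => (p.1, p.2.2))).clm_apply
      continuous_const).measurable
  have hbm : Measurable b := by
    refine Measurable.mul ?_ (hsc.measurable.comp (by fun_prop))
    have hc2 : Continuous fun q : (ℝ × Vel d) × (ℝ × Vel d) => fderiv ℝ θ q.1 q.2 :=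
      (hD1.comp continuous_fst).clm_apply continuous_snd
    refine hc2.measurable.comp (Measurable.prodMk (by fun_prop) (Measurable.prodMk (by fun_prop) ?_))
    exact hE.comp (by fun_prop : Measurable fun p : ℝ × Phase d => (p.1, p.2.1))
  have hab : ∀ p, ‖a p‖ ≤ B * ‖cutoff R R (fun _ _ => 1) p‖ := fun p => by
    by_cases hp : p.1 ≤ R ∧ ‖p.2.2‖ ≤ R
    · have h1 : ‖fderiv ℝ θ (p.1, p.2.2) (1, 0)‖ ≤ B :=
        ((fderiv ℝ θ (p.1, p.2.2)).le_opNorm_of_le (c := 1) (by simp [Prod.norm_def])).trans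
          (by rw [mul_one]; exact hB _)
      have h2 : cutoff R R (fun _ _ => (1 : ℝ)) p = 1 := if_pos hp
      rw [h2, norm_one, ha, norm_mul]
      exact mul_le_mul h1 (hs1 _) (norm_nonneg _) hB0
    · simp only [ha, hcut (p.1, p.2.2) hp]
      simp
      positivity
  have hbb : ∀ p, ‖b p‖ ≤ B * ‖cutoff R R (fun t x => ‖E t x‖) p‖ := fun p => by
    by_cases hp : p.1 ≤ R ∧ ‖p.2.2‖ ≤ R
    · have h1 : ‖fderiv ℝ θ (p.1, p.2.2) (0, E p.1 p.2.1)‖ ≤ B * ‖E p.1 p.2.1‖ :=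
        ((fderiv ℝ θ (p.1, p.2.2)).le_opNorm_of_le (c := ‖E p.1 p.2.1‖)
          (by simp [Prod.norm_def])).trans (by gcongr; exact hB _)
      have h2 : cutoff R R (fun t x => ‖E t x‖) p = ‖E p.1 p.2.1‖ := if_pos hp
      rw [h2, norm_norm, hb, norm_mul]
      calc _ ≤ B * ‖E p.1 p.2.1‖ * 1 := mul_le_mul h1 (hs1 _) (abs_nonneg _) (by positivity)
        _ = _ := mul_one _
    · simp only [hb, hcut (p.1, p.2.2) hp]
      simp
      positivity
  have haI : Integrable a (halfMeasure d) :=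
    (hI1.norm.const_mul B).mono' ham.aestronglyMeasurable (Eventually.of_forall hab)
  have hbI : Integrable b (halfMeasure d) :=
    (hI2.norm.const_mul B).mono' hbm.aestronglyMeasurable (Eventually.of_forall hbb)
  have hmI : Integrable m (halfMeasure d) := integrable_mul_torusChar k _ hs.continuous hcs
  have hgI : ∀ {u : ℝ × Phase d → ℝ}, Integrable u (halfMeasure d) →
      Integrable (fun p => g p * u p) (halfMeasure d) := fun hu =>
    integrable_mul_of_bounds hg.aestronglyMeasurable hg0 hgC hu
  have hgle : ∀ {u w : ℝ × Phase d → ℝ} {M : ℝ}, (∀ p, ‖u p‖ ≤ B * ‖w p‖) →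
      Integrable w (halfMeasure d) → ∫ p, ‖w p‖ ∂(halfMeasure d) ≤ D * M →
      |∫ p, g p * u p ∂(halfMeasure d)| ≤ C * (B * (D * M)) := fun {u w M} huw hw hwM => by
    calc |∫ p, g p * u p ∂(halfMeasure d)| ≤ ∫ p, C * (B * ‖w p‖) ∂(halfMeasure d) := by
          refine norm_integral_le_of_norm_le (G := ℝ) ((hw.norm.const_mul B).const_mul C)
            (Eventually.of_forall fun p => ?_)
          rw [norm_mul, Real.norm_of_nonneg (hg0 p)]
          exact mul_le_mul (hgC p) (huw p) (norm_nonneg _) hC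
      _ ≤ _ := by
          rw [integral_const_mul, integral_const_mul]
          gcongr
  have hga := hgle hab hI1 hb1
  have hgb := hgle hbb hI2 hb2
  have hweak := hw _ (isTestPQ_mul_torusChar k c hθs hθc hθ0)
  have hdiff : Differentiable ℝ θ := hθs.differentiable (by simp)
  have hX : ∀ t z, (deriv (fun r => θ (r, z.2) * (c * torusChar k z.1).re) t
        + (ε ^ 2)⁻¹ * dirDerivT d (fun x => θ (t, z.2) * (c * torusChar k x).re) z.1
            (fun i => z.2 i)
        + ε⁻¹ * deriv (fun r : ℝ => θ (t, z.2 + r • E t z.1) * (c * torusChar k z.1).re) 0)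
      = a (t, z) + (ε ^ 2)⁻¹ * m (t, z) + ε⁻¹ * b (t, z) := by
    intro t z
    have h1 : HasDerivAt (fun r => θ (r, z.2) * (c * torusChar k z.1).re) (a (t, z)) t :=
      ((hdiff (t, z.2)).hasFDerivAt.comp_hasDerivAt t
        ((hasDerivAt_id t).prodMk (hasDerivAt_const t z.2))).mul_const _
    have h2 : HasDerivAt (fun r : ℝ => θ (t, z.2 + r • E t z.1) * (c * torusChar k z.1).re)
        (b (t, z)) 0 := by
      have h3 : HasDerivAt (fun r : ℝ => (t, z.2 + r • E t z.1)) (0, E t z.1) 0 := by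
        refine (hasDerivAt_const 0 t).prodMk ?_
        simpa using ((hasDerivAt_id (0 : ℝ)).smul_const (E t z.1)).const_add z.2
      have h4 : HasFDerivAt θ (fderiv ℝ θ (t, z.2)) (t, z.2 + (0 : ℝ) • E t z.1) := by
        simpa using (hdiff (t, z.2)).hasFDerivAt
      exact (h4.comp_hasDerivAt 0 h3).mul_const _
    rw [h1.deriv, h2.deriv, dirDerivT_torusChar, hθk (t, z.2)]
  simp only [hX] at hweak
  have hsum : Integrable (fun p => a p + (ε ^ 2)⁻¹ * m p + ε⁻¹ * b p) (halfMeasure d) :=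
    (haI.add (hmI.const_mul _)).add (hbI.const_mul _)
  rw [iterated_integral_eq (X := fun p => a p + (ε ^ 2)⁻¹ * m p + ε⁻¹ * b p)
    (ae_restrict_of_forall_mem measurableSet_Ioi hfg) (hgI hsum)] at hweak
  have hsplit : ∫ p, g p * (a p + (ε ^ 2)⁻¹ * m p + ε⁻¹ * b p) ∂(halfMeasure d)
      = ∫ p, g p * a p ∂(halfMeasure d) + (ε ^ 2)⁻¹ * ∫ p, g p * m p ∂(halfMeasure d)
        + ε⁻¹ * ∫ p, g p * b p ∂(halfMeasure d) := by
    have h1 : Integrable (fun p => g p * a p + (ε ^ 2)⁻¹ * (g p * m p)) (halfMeasure d) :=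
      (hgI haI).add ((hgI hmI).const_mul _)
    rw [← integral_const_mul, ← integral_const_mul,
      ← integral_add (hgI haI) ((hgI hmI).const_mul _),
      ← integral_add h1 ((hgI hbI).const_mul _)]
    refine integral_congr_ae (Eventually.of_forall fun p => ?_)
    dsimp only
    ring
  rw [hsplit] at hweak
  set Ia := ∫ p, g p * a p ∂(halfMeasure d)
  set Ib := ∫ p, g p * b p ∂(halfMeasure d)
  change |∫ p, g p * m p ∂(halfMeasure d)| ≤ _
  set Im := ∫ p, g p * m p ∂(halfMeasure d)
  have hIm : Im = -(ε ^ 2 * Ia) - ε * Ib := by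
    field_simp at hweak
    linarith
  have hV0 : 0 ≤ V := measureReal_nonneg
  calc |Im| ≤ |ε ^ 2 * Ia| + |ε * Ib| := by
        rw [hIm]; exact (abs_sub _ _).trans (by rw [abs_neg])
    _ ≤ ε ^ 2 * (C * (B * (D * V))) + ε * (C * (B * (D * A))) := by
        rw [abs_mul, abs_mul, abs_of_pos hε, abs_of_pos (pow_pos hε 2)]
        gcongr
    _ ≤ C * B * D * (V + 1) * (ε ^ 2 + ε * A) := by
        have h1 : 0 ≤ C * B * D * ε ^ 2 := by positivity
        have h2 : 0 ≤ C * B * D * V * (ε * A) := by positivity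
        linarith

/-- The identification of `(ℝ × ℝ^d) × 𝕋^d` with `ℝ × Q`. -/
def sliceEquiv (d : ℕ) : (ℝ × Vel d) × Torus d ≃ᵐ ℝ × Phase d :=
  MeasurableEquiv.prodAssoc.trans
    (MeasurableEquiv.prodCongr (MeasurableEquiv.refl ℝ) MeasurableEquiv.prodComm)

/-- Lebesgue measure on `(0,∞) × ℝ^d`. -/
abbrev halfVelMeasure (d : ℕ) : Measure (ℝ × Vel d) :=
  (volume.restrict (Set.Ioi (0 : ℝ))).prod volume

theorem halfMeasure_eq_restrict (d : ℕ) :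
    halfMeasure d = volume.restrict (Set.Ioi 0 ×ˢ Set.univ) := by
  rw [Measure.volume_eq_prod, ← Measure.prod_restrict, Measure.restrict_univ]

theorem halfVelMeasure_eq_restrict (d : ℕ) :
    halfVelMeasure d = volume.restrict (Set.Ioi 0 ×ˢ Set.univ) := by
  rw [Measure.volume_eq_prod, ← Measure.prod_restrict, Measure.restrict_univ]

theorem measurePreserving_sliceEquiv (d : ℕ) :
    MeasurePreserving (sliceEquiv d) ((halfVelMeasure d).prod volume) (halfMeasure d) :=
  ((MeasurePreserving.id _).prod Measure.measurePreserving_swap).comp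
    (measurePreserving_prodAssoc _ _ _)

theorem integrable_comp_sliceEquiv {d : ℕ} {Y : ℝ × Phase d → ℝ}
    (hY : Integrable Y (halfMeasure d)) :
    Integrable (fun q : (ℝ × Vel d) × Torus d => Y (q.1.1, (q.2, q.1.2)))
      ((halfVelMeasure d).prod volume) :=
  (measurePreserving_sliceEquiv d).integrable_comp_of_integrable hY

theorem integral_halfMeasure {d : ℕ} {Y : ℝ × Phase d → ℝ} (hY : Integrable Y (halfMeasure d)) :
    ∫ p, Y p ∂(halfMeasure d) = ∫ q, (∫ x, Y (q.1, (x, q.2))) ∂(halfVelMeasure d) := by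
  rw [← (measurePreserving_sliceEquiv d).integral_comp' (g := Y)]
  exact integral_prod _ (integrable_comp_sliceEquiv hY)

theorem volume_waveDot_eq_zero {d : ℕ} {k : Fin d → ℤ} (hk : k ≠ 0) :
    volume {v : Vel d | waveDot k (fun i => v i) = 0} = 0 := by
  let L : Vel d →ₗ[ℝ] ℝ :=
    ∑ i, (k i : ℝ) • (EuclideanSpace.proj (𝕜 := ℝ) i : Vel d →L[ℝ] ℝ).toLinearMap
  have hL : ∀ v, L v = waveDot k (fun i => v i) := fun v => by simp [L, waveDot]
  have hs : {v : Vel d | waveDot k (fun i => v i) = 0} = (LinearMap.ker L : Set (Vel d)) := by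
    ext v; simp [hL]
  rw [hs]
  refine Measure.addHaar_submodule _ _ fun htop => hk ?_
  funext j
  have : EuclideanSpace.single j (1 : ℝ) ∈ LinearMap.ker L := htop ▸ Submodule.mem_top
  rw [LinearMap.mem_ker, hL] at this
  simpa [waveDot] using this

theorem ae_fourierMode_eq_zero {d : ℕ} {k : Fin d → ℤ} (hk : k ≠ 0) (c : ℂ)
    {F : ℝ × Phase d → ℝ} {C : ℝ} (hF : Measurable F) (h0 : ∀ p, 0 ≤ F p) (hC : ∀ p, F p ≤ C)
    (hint : ∀ h : ℝ × Vel d → ℝ, ContDiff ℝ (⊤ : ℕ∞) h → HasCompactSupport h →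
      tsupport h ⊆ {p | 0 < p.1 ∧ waveDot k (fun i => p.2 i) ≠ 0} →
      ∫ p, F p * (h (p.1, p.2.2) * (c * torusChar k p.2.1).re) ∂(halfMeasure d) = 0) :
    ∀ᵐ q ∂(halfVelMeasure d), ∫ x, F (q.1, (x, q.2)) * (c * torusChar k x).re = 0 := by
  set U : Set (ℝ × Vel d) := {p | 0 < p.1 ∧ waveDot k (fun i => p.2 i) ≠ 0} with hU
  have hUo : IsOpen U := (isOpen_lt continuous_const continuous_fst).inter
    (isOpen_ne_fun ((contDiff_waveDot k).continuous.comp continuous_snd) continuous_const)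
  set s : Torus d → ℝ := fun x => (c * torusChar k x).re with hs
  have hsc : Continuous s := continuous_re_torusChar k c
  set G : ℝ × Vel d → ℝ := fun q => ∫ x, F (q.1, (x, q.2)) * s x with hG
  have hGm : StronglyMeasurable G := by
    refine StronglyMeasurable.integral_prod_right
      (f := fun (q : ℝ × Vel d) (x : Torus d) => F (q.1, (x, q.2)) * s x) ?_
    exact ((hF.comp (by fun_prop)).mul (hsc.measurable.comp measurable_snd)).stronglyMeasurable
  have hsI : Integrable s := hsc.integrable_of_hasCompactSupport (HasCompactSupport.of_compactSpace s)
  have hGb : ∀ q, ‖G q‖ ≤ C * ∫ x, ‖s x‖ := fun q => by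
    rw [← integral_const_mul]
    refine norm_integral_le_of_norm_le (hsI.norm.const_mul C) (Eventually.of_forall fun x => ?_)
    rw [norm_mul, Real.norm_of_nonneg (h0 _)]
    exact mul_le_mul_of_nonneg_right (hC _) (norm_nonneg _)
  have hGl : LocallyIntegrable G volume :=
    (locallyIntegrable_const (C * ∫ x, ‖s x‖)).mono hGm.aestronglyMeasurable
      (Eventually.of_forall fun q => (hGb q).trans (le_abs_self _))
  have hae : ∀ᵐ q : ℝ × Vel d, q ∈ U → G q = 0 := by
    refine hUo.ae_eq_zero_of_integral_contDiff_smul_eq_zero (hGl.locallyIntegrableOn _)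
      fun h hh hhc hhU => ?_
    have h1 := hint h hh hhc hhU
    rw [integral_halfMeasure (integrable_mul_of_bounds hF.aestronglyMeasurable h0 hC
      (integrable_mul_torusChar k c hh.continuous hhc))] at h1
    rw [← h1]
    rw [halfVelMeasure_eq_restrict, setIntegral_eq_integral_of_forall_compl_eq_zero]
    · refine integral_congr_ae (Eventually.of_forall fun q => ?_)
      simp only [hG, smul_eq_mul, ← integral_const_mul]
      refine integral_congr_ae (Eventually.of_forall fun x => ?_)
      simp only [hs]
      ring
    · intro q hq
      have : h q = 0 := image_eq_zero_of_notMem_tsupport fun hmem =>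
        hq ⟨(hhU hmem).1, Set.mem_univ _⟩
      simp [this]
  have hpl : ∀ᵐ q : ℝ × Vel d, waveDot k (fun i => q.2 i) ≠ 0 := by
    have := Measure.quasiMeasurePreserving_snd (μ := (volume : Measure ℝ))
      (ν := (volume : Measure (Vel d)))
    exact this.ae (p := fun v => waveDot k (fun i => v i) ≠ 0)
      (by rw [ae_iff]; simpa using volume_waveDot_eq_zero hk)
  rw [halfVelMeasure_eq_restrict, ae_restrict_iff' (measurableSet_Ioi.prod MeasurableSet.univ)]
  filter_upwards [hae, hpl] with q h1 h2 hq
  exact h1 ⟨hq.1, h2⟩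

theorem ae_eq_average {d : ℕ} {F : ℝ × Phase d → ℝ} {C : ℝ} (hF : Measurable F)
    (h0 : ∀ p, 0 ≤ F p) (hC : ∀ p, F p ≤ C)
    (hint : ∀ k : Fin d → ℤ, k ≠ 0 → ∀ c : ℂ, ‖c‖ = 1 → ∀ h : ℝ × Vel d → ℝ,
      ContDiff ℝ (⊤ : ℕ∞) h → HasCompactSupport h →
      tsupport h ⊆ {p | 0 < p.1 ∧ waveDot k (fun i => p.2 i) ≠ 0} →
      ∫ p, F p * (h (p.1, p.2.2) * (c * torusChar k p.2.1).re) ∂(halfMeasure d) = 0) :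
    ∀ᵐ p ∂(halfMeasure d), F p = ((2 * Real.pi) ^ d)⁻¹ * ∫ x, F (p.1, (x, p.2.2)) := by
  have hmode : ∀ᵐ q ∂(halfVelMeasure d), ∀ k : Fin d → ℤ, k ≠ 0 →
      ∫ x, (F (q.1, (x, q.2)) : ℂ) * torusChar k x = 0 := by
    rw [ae_all_iff]
    intro k
    by_cases hk : k = 0
    · exact Eventually.of_forall fun q hk' => absurd hk hk'
    · filter_upwards [ae_fourierMode_eq_zero hk 1 hF h0 hC (hint k hk 1 (by simp)),
        ae_fourierMode_eq_zero hk (-Complex.I) hF h0 hC (hint k hk _ (by simp))] with q h1 h2 _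
      have hFq : Measurable fun x => F (q.1, (x, q.2)) := hF.comp (by fun_prop)
      have hI : Integrable fun x => (F (q.1, (x, q.2)) : ℂ) * torusChar k x := by
        refine Integrable.of_bound (C := C) ((Complex.measurable_ofReal.comp hFq).mul
          (continuous_torusChar k).measurable).aestronglyMeasurable
          (Eventually.of_forall fun x => ?_)
        rw [norm_mul, norm_torusChar, mul_one, Complex.norm_real, Real.norm_of_nonneg (h0 _)]
        exact hC _
      apply Complex.ext
      · rw [← Complex.reCLM_apply, ← ContinuousLinearMap.integral_comp_comm _ hI]
        simpa using h1
      · rw [← Complex.imCLM_apply, ← ContinuousLinearMap.integral_comp_comm _ hI]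
        simpa using h2
  have hm : MeasurableSet {p : ℝ × Phase d |
      F p = ((2 * Real.pi) ^ d)⁻¹ * ∫ x, F (p.1, (x, p.2.2))} := by
    refine measurableSet_eq_fun hF (Measurable.const_mul ?_ _)
    refine (StronglyMeasurable.integral_prod_right
      (f := fun (p : ℝ × Phase d) (x : Torus d) => F (p.1, (x, p.2.2))) ?_).measurable
    exact (hF.comp (by fun_prop)).stronglyMeasurable
  rw [← (measurePreserving_sliceEquiv d).map_eq,
    ae_map_iff (sliceEquiv d).measurable.aemeasurable hm]
  refine (Measure.ae_prod_iff_ae_ae ((sliceEquiv d).measurable hm)).2 ?_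
  filter_upwards [hmode] with q hq
  exact ae_eq_average_of_torusChar (hF.comp (by fun_prop)) (fun x => h0 _) (fun x => hC _) hq

theorem ofReal_integral_mul_indicator {d : ℕ} {g : ℝ × Phase d → ℝ} {C : ℝ} (hg : Measurable g)
    (h0 : ∀ p, 0 ≤ g p) (hC : ∀ p, g p ≤ C) {S : Set ℝ} {B : Set (Phase d)}
    (hS : MeasurableSet S) (hB : MeasurableSet B)
    (hi : Integrable ((S ×ˢ B).indicator fun _ => (1 : ℝ)) (halfMeasure d)) :
    ENNReal.ofReal (∫ p, g p * (S ×ˢ B).indicator (fun _ => (1 : ℝ)) p ∂(halfMeasure d))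
      = ∫⁻ t in S, (∫⁻ z in B, ENNReal.ofReal (g (t, z))) ∂(volume.restrict (Set.Ioi 0)) := by
  rw [ofReal_integral_eq_lintegral_ofReal
    (integrable_mul_of_bounds hg.aestronglyMeasurable h0 hC hi)
    (Eventually.of_forall fun p => mul_nonneg (h0 p) (Set.indicator_nonneg (by simp) p))]
  have h1 : ∀ p, ENNReal.ofReal (g p * (S ×ˢ B).indicator (fun _ => (1 : ℝ)) p)
      = (S ×ˢ B).indicator (fun p => ENNReal.ofReal (g p)) p := fun p => by
    by_cases hp : p ∈ S ×ˢ B <;> simp [hp]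
  simp_rw [h1]
  rw [lintegral_indicator (hS.prod hB), ← Measure.prod_restrict]
  exact lintegral_prod _ hg.ennreal_ofReal.aemeasurable

theorem ae_lintegral_le_of_tendsto {d : ℕ} {g : ℕ → ℝ × Phase d → ℝ} {F : ℝ × Phase d → ℝ}
    {C : ℝ} (hg : ∀ n, Measurable (g n)) (hg0 : ∀ n p, 0 ≤ g n p) (hgC : ∀ n p, g n p ≤ C)
    (hF : Measurable F) (h0 : ∀ p, 0 ≤ F p) (hC : ∀ p, F p ≤ C)
    (hlim : ∀ u, Integrable u (halfMeasure d) →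
      Tendsto (fun n => ∫ p, g n p * u p ∂(halfMeasure d)) atTop
        (𝓝 (∫ p, F p * u p ∂(halfMeasure d))))
    {M : ℝ≥0∞} (hM : ∀ n, ∀ t > 0, ∫⁻ z, ENNReal.ofReal (g n (t, z)) ≤ M) :
    ∀ᵐ t ∂(volume.restrict (Set.Ioi (0 : ℝ))), ∫⁻ z, ENNReal.ofReal (F (t, z)) ≤ M := by
  set B : ℕ → Set (Phase d) := fun R => Set.univ ×ˢ Metric.closedBall 0 (R : ℝ) with hB
  have hBm : ∀ R, MeasurableSet (B R) := fun R =>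
    MeasurableSet.univ.prod Metric.isClosed_closedBall.measurableSet
  have hBf : ∀ R, volume (B R) < ⊤ := fun R => by
    rw [hB, Measure.volume_eq_prod, Measure.prod_prod]
    exact ENNReal.mul_lt_top (measure_lt_top _ _) measure_closedBall_lt_top
  have hR : ∀ R, ∀ᵐ t ∂(volume.restrict (Set.Ioi (0 : ℝ))),
      ∫⁻ z in B R, ENNReal.ofReal (F (t, z)) ≤ M := fun R => by
    refine ae_le_of_forall_setLIntegral_le_of_sigmaFinite
      (hF.ennreal_ofReal.lintegral_prod_right' (ν := volume.restrict (B R))) fun S hS hSf => ?_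
    have hi : Integrable ((S ×ˢ B R).indicator fun _ => (1 : ℝ)) (halfMeasure d) := by
      refine (integrable_indicator_iff (hS.prod (hBm R))).2 (integrableOn_const ?_)
      rw [Measure.prod_prod]
      exact (ENNReal.mul_lt_top hSf (hBf R)).ne
    rw [← ofReal_integral_mul_indicator hF h0 hC hS (hBm R) hi]
    refine le_of_tendsto ((ENNReal.continuous_ofReal.tendsto _).comp (hlim _ hi))
      (Eventually.of_forall fun n => ?_)
    simp only [Function.comp_apply]
    rw [ofReal_integral_mul_indicator (hg n) (hg0 n) (hgC n) hS (hBm R) hi]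
    refine lintegral_mono_ae (ae_restrict_of_ae ?_)
    filter_upwards [ae_restrict_mem measurableSet_Ioi] with t ht
    exact (setLIntegral_le_lintegral _ _).trans (hM n t ht)
  filter_upwards [ae_all_iff.2 hR] with t ht
  have hU : ⋃ R, B R = Set.univ := by
    refine Set.eq_univ_of_forall fun z => Set.mem_iUnion.2 ?_
    obtain ⟨R, hR⟩ := exists_nat_ge ‖z.2‖
    exact ⟨R, Set.mem_univ _, mem_closedBall_zero_iff.2 hR⟩
  have hmono : Monotone B := fun R R' hRR' =>
    Set.prod_mono_right (Metric.closedBall_subset_closedBall (by exact_mod_cast hRR'))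
  rw [← setLIntegral_univ, ← hU, setLIntegral_iUnion_of_directed _ hmono.directed_le]
  exact iSup_le ht

theorem integral_mul_snd {d : ℕ} {w : Phase d → ℝ} {b : Vel d → ℝ} {C : ℝ} (a : ℝ)
    (hw : Measurable w) (hC : ∀ᵐ z, ‖w z‖ ≤ C) (hb : Integrable b) :
    ∫ z : Phase d, w z * (a * b z.2) = ∫ v, (a * ∫ x, w (x, v)) * b v := by
  have hi : Integrable fun z : Phase d => w z * (a * b z.2) :=
    ((hb.const_mul a).comp_snd (volume : Measure (Torus d))).bdd_mul hw.aestronglyMeasurable hC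
  rw [Measure.volume_eq_prod, integral_prod_symm _ hi]
  refine integral_congr_ae (Eventually.of_forall fun v => ?_)
  simp only [integral_mul_const]
  ring

theorem integrable_comp_vel {d : ℕ} {u : ℝ × Vel d → ℝ} (hu : Integrable u (halfVelMeasure d)) :
    Integrable (fun p : ℝ × Phase d => u (p.1, p.2.2)) (halfMeasure d) :=
  ((measurePreserving_sliceEquiv d).integrable_comp_emb (sliceEquiv d).measurableEmbedding).1
    (hu.comp_fst (volume : Measure (Torus d)))

theorem lintegral_enorm_le_of_eLpNorm_two {d : ℕ} {E : Torus d → Vel d} {K : ℝ} (hE : Measurable E)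
    (hK : eLpNorm E 2 volume ≤ ENNReal.ofReal K) :
    ∫⁻ x, ‖E x‖ₑ ≤ ENNReal.ofReal (|K| * ((2 * Real.pi) ^ d) ^ (1 / 2 : ℝ)) := by
  rw [← eLpNorm_one_eq_lintegral_enorm]
  refine (eLpNorm_le_eLpNorm_mul_rpow_measure_univ (p := 1) (q := 2) (by norm_num)
    hE.aestronglyMeasurable).trans ?_
  have hV : (volume : Measure (Torus d)) Set.univ = ENNReal.ofReal ((2 * Real.pi) ^ d) := by
    rw [← volume_real_torus, ofReal_measureReal]
  rw [hV, ENNReal.ofReal_mul (abs_nonneg K)]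
  refine mul_le_mul' (hK.trans (ENNReal.ofReal_le_ofReal (le_abs_self K))) ?_
  rw [ENNReal.ofReal_rpow_of_nonneg (by positivity) (by norm_num)]
  norm_num

open Classical in
/-- Space average of `F`, set to zero at the times where `F` has mass larger than `M`. -/
def averageLimit {d : ℕ} (M : ℝ≥0∞) (F : ℝ × Phase d → ℝ) (t : ℝ) (v : Vel d) : ℝ :=
  if ∫⁻ z, ENNReal.ofReal (F (t, z)) ≤ M then ((2 * Real.pi) ^ d)⁻¹ * ∫ x, F (t, (x, v)) else 0

theorem averageLimit_of_le {d : ℕ} {M : ℝ≥0∞} {F : ℝ × Phase d → ℝ} {t : ℝ}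
    (h : ∫⁻ z, ENNReal.ofReal (F (t, z)) ≤ M) (v : Vel d) :
    averageLimit M F t v = ((2 * Real.pi) ^ d)⁻¹ * ∫ x, F (t, (x, v)) :=
  if_pos h

theorem averageLimit_of_not_le {d : ℕ} {M : ℝ≥0∞} {F : ℝ × Phase d → ℝ} {t : ℝ}
    (h : ¬ ∫⁻ z, ENNReal.ofReal (F (t, z)) ≤ M) : averageLimit M F t = 0 :=
  funext fun _ => if_neg h

theorem measurable_averageLimit {d : ℕ} {M : ℝ≥0∞} {F : ℝ × Phase d → ℝ} (hF : Measurable F)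
    (t : ℝ) : Measurable (averageLimit M F t) := by
  by_cases h : ∫⁻ z, ENNReal.ofReal (F (t, z)) ≤ M
  · rw [funext (averageLimit_of_le h)]
    refine Measurable.const_mul ?_ _
    refine (StronglyMeasurable.integral_prod_right
      (f := fun (v : Vel d) (x : Torus d) => F (t, (x, v))) ?_).measurable
    exact (hF.comp (by fun_prop)).stronglyMeasurable
  · rw [averageLimit_of_not_le h]
    exact measurable_zero

theorem norm_averageLimit_le {d : ℕ} {M : ℝ≥0∞} {F : ℝ × Phase d → ℝ} {C : ℝ} (hC0 : 0 ≤ C)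
    (h0 : ∀ p, 0 ≤ F p) (hC : ∀ p, F p ≤ C) (t : ℝ) (v : Vel d) : ‖averageLimit M F t v‖ ≤ C := by
  by_cases h : ∫⁻ z, ENNReal.ofReal (F (t, z)) ≤ M
  · rw [averageLimit_of_le h, norm_mul, norm_inv, norm_pow, Real.norm_of_nonneg two_pi_pos.le]
    have h1 : ‖∫ x, F (t, (x, v))‖ ≤ C * (2 * Real.pi) ^ d := by
      rw [← volume_real_torus]
      exact norm_integral_le_of_norm_le_const (Eventually.of_forall fun x => by
        rw [Real.norm_of_nonneg (h0 _)]; exact hC _)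
    have h2 : (0 : ℝ) < (2 * Real.pi) ^ d := by positivity
    exact (inv_mul_le_iff₀ h2).2 (h1.trans_eq (mul_comm _ _))
  · rw [averageLimit_of_not_le h]
    simpa using hC0

theorem eLpNorm_one_averageLimit_le {d : ℕ} {M : ℝ≥0∞} {F : ℝ × Phase d → ℝ} (hF : Measurable F)
    (h0 : ∀ p, 0 ≤ F p) (t : ℝ) :
    eLpNorm (averageLimit M F t) 1 volume ≤ ENNReal.ofReal ((2 * Real.pi) ^ d)⁻¹ * M := by
  by_cases h : ∫⁻ z, ENNReal.ofReal (F (t, z)) ≤ M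
  · rw [eLpNorm_one_eq_lintegral_enorm]
    calc ∫⁻ v, ‖averageLimit M F t v‖ₑ
        ≤ ∫⁻ v, ENNReal.ofReal ((2 * Real.pi) ^ d)⁻¹ * ∫⁻ x, ENNReal.ofReal (F (t, (x, v))) := by
          refine lintegral_mono fun v => ?_
          rw [averageLimit_of_le h, enorm_mul, Real.enorm_of_nonneg (by positivity)]
          gcongr
          refine (enorm_integral_le_lintegral_enorm _).trans_eq (lintegral_congr fun x => ?_)
          rw [Real.enorm_of_nonneg (h0 _)]
      _ = ENNReal.ofReal ((2 * Real.pi) ^ d)⁻¹ * ∫⁻ z, ENNReal.ofReal (F (t, z)) := by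
          rw [lintegral_const_mul' _ _ ENNReal.ofReal_ne_top, Measure.volume_eq_prod,
            lintegral_prod_symm (fun z : Phase d => ENNReal.ofReal (F (t, z)))
              (hF.ennreal_ofReal.comp measurable_prodMk_left).aemeasurable]
      _ ≤ _ := by gcongr
  · rw [averageLimit_of_not_le h]
    simp

/-- uniform `L¹ ∩ L^∞` and energy bounds on weak solutions of the rescaled
Vlasov–Poisson system yield, along a subsequence, a weak-∗ limit `f = f(t,v)` in
`L^∞(ℝ^+; L^∞(Q))` which is independent of `x`, and the space averages converge weak-∗ to the
same limit. -/
theorem stmt1 (d : ℕ) (hd : 1 ≤ d) (ε : ℕ → ℝ) (hεpos : ∀ n, 0 < ε n)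
    (hε0 : Tendsto ε atTop (𝓝 0))
    (f : ℕ → ℝ → Phase d → ℝ) (E : ℕ → ℝ → Torus d → Vel d) (Φ : ℕ → ℝ → Torus d → ℝ)
    (hsol : ∀ n, IsWeakSolVP d (ε n) (f n) (E n) (Φ n))
    (C₀ K₀ : ℝ)
    (hfbound : ∀ n, ∀ t ≥ (0 : ℝ),
      eLpNorm (f n t) 1 volume + eLpNorm (f n t) ⊤ volume ≤ ENNReal.ofReal C₀)
    (hkin : ∀ n, ∀ t ≥ (0 : ℝ), (∫ z : Phase d, ‖z.2‖ ^ 2 * f n t z) ≤ K₀)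
    (hEbound : ∀ n, ∀ t ≥ (0 : ℝ),
      eLpNorm (E n t) 2 volume ≤ ENNReal.ofReal (K₀ / Real.sqrt (ε n))) :
    ∃ σ : ℕ → ℕ, StrictMono σ ∧ ∃ flim : ℝ → Vel d → ℝ,
      -- `flim ∈ L^∞(ℝ^+; L¹ ∩ L^∞(ℝ^d))`
      (∃ M : ℝ≥0∞, M < ⊤ ∧ ∀ t ≥ (0 : ℝ),
        eLpNorm (flim t) 1 volume + eLpNorm (flim t) ⊤ volume ≤ M) ∧
      -- `f^{ε_n} ⇀ flim` in `L^∞(ℝ^+; L^∞(Q))` weak-∗ (the limit does not depend on `x`)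
      (∀ u : ℝ × Phase d → ℝ, Integrable u (volume.restrict (Set.Ioi 0 ×ˢ Set.univ)) →
        Tendsto (fun n => ∫ t in Set.Ioi (0 : ℝ), ∫ z : Phase d, f (σ n) t z * u (t, z)) atTop
          (𝓝 (∫ t in Set.Ioi (0 : ℝ), ∫ z : Phase d, flim t z.2 * u (t, z)))) ∧
      -- `⨍ f^{ε_n} dx ⇀ flim` in `L^∞(ℝ^+; L^∞(ℝ^d))` weak-∗
      (∀ u : ℝ × Vel d → ℝ, Integrable u (volume.restrict (Set.Ioi 0 ×ˢ Set.univ)) →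
        Tendsto (fun n => ∫ t in Set.Ioi (0 : ℝ), ∫ v : Vel d,
            (((2 * Real.pi) ^ d)⁻¹ * ∫ x : Torus d, f (σ n) t (x, v)) * u (t, v)) atTop
          (𝓝 (∫ t in Set.Ioi (0 : ℝ), ∫ v : Vel d, flim t v * u (t, v)))) := by
  set M : ℝ≥0∞ := ENNReal.ofReal C₀ with hM
  set C : ℝ := M.toReal with hCdef
  have hMt : M ≠ ⊤ := ENNReal.ofReal_ne_top
  have hC0 : 0 ≤ C := ENNReal.toReal_nonneg
  have hfm : ∀ n t, Measurable (f n t) := fun n t =>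
    (hsol n).fmeas.comp (measurable_prodMk_left (x := t))
  have hfC : ∀ n, ∀ t ≥ (0 : ℝ), ∀ᵐ z, f n t z ≤ C := fun n t ht => by
    have h1 : eLpNormEssSup (f n t) volume ≤ M := by
      rw [← eLpNorm_exponent_top]
      exact le_add_self.trans (hfbound n t ht)
    filter_upwards [ae_le_eLpNormEssSup (f := f n t) (μ := volume)] with z hz
    rw [Real.enorm_of_nonneg ((hsol n).nonneg t z)] at hz
    exact (ENNReal.ofReal_le_iff_le_toReal hMt).1 (hz.trans h1)
  set g : ℕ → ℝ × Phase d → ℝ := fun n p => min (f n p.1 p.2) C with hg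
  have hgm : ∀ n, Measurable (g n) := fun n => (hsol n).fmeas.min measurable_const
  have hg0 : ∀ n p, 0 ≤ g n p := fun n p => le_min ((hsol n).nonneg _ _) hC0
  have hgC : ∀ n p, g n p ≤ C := fun n p => min_le_right _ _
  have hfg : ∀ n, ∀ t > (0 : ℝ), ∀ᵐ z, f n t z = g n (t, z) := fun n t ht => by
    filter_upwards [hfC n t (le_of_lt ht)] with z hz
    exact (min_eq_left hz).symm
  have hgM : ∀ n, ∀ t > (0 : ℝ), ∫⁻ z, ENNReal.ofReal (g n (t, z)) ≤ M := fun n t ht => by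
    refine le_trans ?_ (le_self_add.trans (hfbound n t (le_of_lt ht)))
    rw [eLpNorm_one_eq_lintegral_enorm]
    refine lintegral_mono fun z => ?_
    rw [Real.enorm_of_nonneg ((hsol n).nonneg t z)]
    exact ENNReal.ofReal_le_ofReal (min_le_left _ _)
  set V : ℝ := ((2 * Real.pi) ^ d) ^ (1 / 2 : ℝ) with hV
  set A : ℕ → ℝ := fun n => |K₀ / Real.sqrt (ε n)| * V with hA
  have hA0 : ∀ n, 0 ≤ A n := fun n => by positivity
  have hEA : ∀ n, ∀ t > (0 : ℝ), ∫⁻ x, ‖E n t x‖ₑ ≤ ENNReal.ofReal (A n) := fun n t ht =>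
    lintegral_enorm_le_of_eLpNorm_two
      ((hsol n).Emeas.comp (measurable_prodMk_left (x := t))) (hEbound n t (le_of_lt ht))
  have hεA : Tendsto (fun n => ε n ^ 2 + ε n * A n) atTop (𝓝 0) := by
    have h1 : ∀ n, ε n ^ 2 + ε n * A n = ε n ^ 2 + |K₀| * V * Real.sqrt (ε n) := fun n => by
      have h2 : ε n * (|K₀| / Real.sqrt (ε n) * V) = |K₀| * V * (ε n / Real.sqrt (ε n)) := by ring
      simp only [hA, abs_div, abs_of_pos (Real.sqrt_pos.2 (hεpos n))]
      rw [h2, Real.div_sqrt]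
    simp_rw [h1]
    have h2 := (hε0.pow 2).add ((hε0.sqrt).const_mul (|K₀| * V))
    simpa using h2
  obtain ⟨σ, hσ, F, hFm, hF0, hFC, hlim⟩ :=
    exists_subseq_weakStar (halfMeasure d) g C hC0 hgm hg0 hgC
  have hmode : ∀ k : Fin d → ℤ, k ≠ 0 → ∀ c : ℂ, ‖c‖ = 1 → ∀ h : ℝ × Vel d → ℝ,
      ContDiff ℝ (⊤ : ℕ∞) h → HasCompactSupport h →
      tsupport h ⊆ {p | 0 < p.1 ∧ waveDot k (fun i => p.2 i) ≠ 0} →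
      ∫ p, F p * (h (p.1, p.2.2) * (c * torusChar k p.2.1).re) ∂(halfMeasure d) = 0 := by
    intro k _ c hc h hh hhc hhs
    have hc' : -Complex.I * c * Complex.I = c := by
      linear_combination (-c) * Complex.I_mul_I
    obtain ⟨D, hD⟩ := weakVlasov_mode_bound (k := k) (c := -Complex.I * c) (by simp [hc]) hh hhc hhs
      hC0
    rw [hc'] at hD
    refine tendsto_nhds_unique (hlim _ (integrable_mul_torusChar k c hh.continuous hhc))
      (squeeze_zero_norm (fun n => hD (ε (σ n)) (f (σ n)) (E (σ n)) (A (σ n)) (g (σ n))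
        (hεpos _) (hA0 _) (hgm _) (hg0 _) (hgC _) (hfg _) (hsol _).Emeas (hEA _) (hsol _).vlasov) ?_)
    simpa using (hεA.comp hσ.tendsto_atTop).const_mul D
  have hFM := ae_lintegral_le_of_tendsto (fun n => hgm (σ n)) (fun n => hg0 (σ n))
    (fun n => hgC (σ n)) hFm hF0 hFC hlim (fun n => hgM (σ n))
  have hFl : ∀ᵐ t ∂(volume.restrict (Set.Ioi 0)), ∀ᵐ z : Phase d,
      averageLimit M F t z.2 = F (t, z) := by
    filter_upwards [hFM, Measure.ae_ae_of_ae_prod (ae_eq_average hFm hF0 hFC hmode)] with t ht hz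
    filter_upwards [hz] with z hz
    rw [averageLimit_of_le ht, hz]
  have hweak : ∀ u : ℝ × Phase d → ℝ, Integrable u (halfMeasure d) →
      Tendsto (fun n => ∫ t in Set.Ioi (0 : ℝ), ∫ z : Phase d, f (σ n) t z * u (t, z)) atTop
        (𝓝 (∫ t in Set.Ioi (0 : ℝ), ∫ z : Phase d, averageLimit M F t z.2 * u (t, z))) := by
    intro u hu
    rw [iterated_integral_eq (f := fun t z => averageLimit M F t z.2) hFl
      (integrable_mul_of_bounds hFm.aestronglyMeasurable hF0 hFC hu)]
    refine (hlim u hu).congr fun n => (iterated_integral_eq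
      (ae_restrict_of_forall_mem measurableSet_Ioi (hfg (σ n))) ?_).symm
    exact integrable_mul_of_bounds (hgm _).aestronglyMeasurable (hg0 _) (hgC _) hu
  refine ⟨σ, hσ, averageLimit M F, ⟨ENNReal.ofReal ((2 * Real.pi) ^ d)⁻¹ * M + ENNReal.ofReal C,
    by finiteness, fun t _ => ?_⟩, ?_, ?_⟩
  · refine add_le_add (eLpNorm_one_averageLimit_le hFm hF0 t) ?_
    rw [eLpNorm_exponent_top]
    exact eLpNormEssSup_le_of_ae_bound
      (Eventually.of_forall fun v => norm_averageLimit_le hC0 hF0 hFC t v)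
  · rw [← halfMeasure_eq_restrict]
    exact hweak
  · rw [← halfVelMeasure_eq_restrict]
    intro u hu
    set a : ℝ := ((2 * Real.pi) ^ d)⁻¹ with ha
    have hut : ∀ᵐ t ∂(volume.restrict (Set.Ioi 0)), Integrable fun v => u (t, v) :=
      hu.prod_right_ae
    have hlim' := hweak (fun p => a * u (p.1, p.2.2)) ((integrable_comp_vel hu).const_mul a)
    have hF' : ∫ t in Set.Ioi (0 : ℝ), ∫ z : Phase d, averageLimit M F t z.2 * (a * u (t, z.2))
        = ∫ t in Set.Ioi (0 : ℝ), ∫ v, averageLimit M F t v * u (t, v) := by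
      refine integral_congr_ae ?_
      filter_upwards [hut] with t ht
      rw [integral_mul_snd (w := fun z => averageLimit M F t z.2) a
        ((measurable_averageLimit hFm t).comp measurable_snd)
        (Eventually.of_forall fun z => norm_averageLimit_le hC0 hF0 hFC t z.2) ht]
      refine integral_congr_ae (Eventually.of_forall fun v => ?_)
      have hpos : (2 * Real.pi) ^ d ≠ 0 := by positivity
      simp only [integral_const, volume_real_torus, smul_eq_mul, ha]
      rw [inv_mul_cancel_left₀ hpos]
    rw [← hF']
    refine hlim'.congr fun n => integral_congr_ae ?_
    filter_upwards [hut, ae_restrict_mem measurableSet_Ioi] with t ht ht0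
    refine integral_mul_snd (C := C) a (hfm _ t) ?_ ht
    filter_upwards [hfC (σ n) t (le_of_lt ht0)] with z hz
    rwa [Real.norm_of_nonneg ((hsol (σ n)).nonneg t z)]
end
end

section
/- Let d ≥ 1 and 𝜏 > 0 finite. Let (Ω,ℱ,ℙ) be a probability space and E : ℝ^+ × ℝ^+ × 𝕋^d × Ω → ℝ^d a jointly measurable, bounded random field satisfying (H1) 𝔼[E(t,τ,x)] = 0; (H2) E(t,τ,x) and E(s,σ,y) are independent whenever |τ−σ| ≥ 𝜏; (H3) 𝔼[E(t,τ,x) ⊗ E(s,σ,y)] = ℛ_𝜏(t,s,τ−σ,x−y) with ℛ_𝜏(t,t,·,·) bounded. Then for every t ≥ 0 and v ∈ ℝ^d, the symmetric part of the diffusion matrix 𝒟_𝜏(t,v) := ∫_0^𝜏 ℛ_𝜏(t,t,σ,σv) dσ is positive semidefinite: X^T 𝒟_𝜏(t,v) X ≥ 0 for every X ∈ ℝ^d. -/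
open MeasureTheory ProbabilityTheory Real Filter Topology intervalIntegral

noncomputable section

/-- A bounded process `g` with stationary autocorrelation `r`, vanishing beyond the lag `τ`,
satisfies the Green–Kubo positivity `0 ≤ ∫_0^τ r`. -/
theorem integral_autocorrelation_nonneg {Ω : Type*} [MeasurableSpace Ω] (P : Measure Ω)
    [IsProbabilityMeasure P] {g : ℝ → Ω → ℝ} (hg : Measurable fun p : ℝ × Ω => g p.1 p.2)
    {B : ℝ} (hB : ∀ s ω, |g s ω| ≤ B) {r : ℝ → ℝ} (hr : Measurable r)
    (hcorr : ∀ s u, ∫ ω, g s ω * g u ω ∂P = r (s - u)) {τ : ℝ}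
    (hτ : 0 < τ) (hdecor : ∀ σ, τ ≤ σ → r σ = 0) :
    0 ≤ ∫ σ in (0 : ℝ)..τ, r σ := by
  have hprod : ∀ s u ω, ‖g s ω * g u ω‖ ≤ B * B := fun s u ω => by
    rw [Real.norm_eq_abs, abs_mul]
    exact mul_le_mul (hB s ω) (hB u ω) (abs_nonneg _) ((abs_nonneg _).trans (hB s ω))
  have hr_bound : ∀ x, ‖r x‖ ≤ B * B := fun x => by
    have h := norm_integral_le_of_norm_le_const (μ := P) (.of_forall (hprod x 0))
    rw [hcorr] at h
    simpa using h
  have hr_even : ∀ x, r (-x) = r x := fun x => by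
    have h1 := hcorr 0 x
    have h2 := hcorr x 0
    simp only [mul_comm (g 0 _), zero_sub, sub_zero] at h1 h2
    rw [← h1, h2]
  have hr_int : ∀ a b, IntervalIntegrable r volume a b := fun a b =>
    (intervalIntegrable_const (c := B * B)).mono_fun hr.aestronglyMeasurable
      (.of_forall fun x => (hr_bound x).trans (le_abs_self _))
  set R : ℝ → ℝ := fun x => ∫ y in (0 : ℝ)..x, r y with hR
  have hR_cont : Continuous R := continuous_primitive hr_int 0
  have hR_odd : ∀ x, R (-x) = -R x := fun x => by
    have h := integral_comp_neg (a := 0) (b := x) r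
    simp only [hr_even, neg_zero] at h
    simp only [hR]
    rw [integral_symm, ← h]
  have hR_const : ∀ x, τ ≤ x → R x = R τ := fun x hx => by
    have h : ∫ y in τ..x, r y = 0 := by
      rw [integral_congr (g := fun _ => (0 : ℝ))]
      · simp
      · intro y hy
        rw [Set.uIcc_of_le hx] at hy
        exact hdecor y hy.1
    simp only [hR]
    rw [← integral_add_adjacent_intervals (hr_int 0 τ) (hr_int τ x), h, add_zero]
  have hvariance : ∀ T, 0 ≤ T → 0 ≤ ∫ s in (0 : ℝ)..T, R s := fun T hT => by
    have hsq : 0 ≤ ∫ ω, (∫ s in Set.Ioc 0 T, g s ω) * (∫ s in Set.Ioc 0 T, g s ω) ∂P :=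
      integral_nonneg fun ω => mul_self_nonneg _
    simp only [← integral_prod_mul] at hsq
    rw [integral_integral_swap] at hsq
    · simp only [hcorr] at hsq
      rw [integral_prod] at hsq
      · have hinner : ∀ s, ∫ u in Set.Ioc 0 T, r (s - u) = R s + R (T - s) := fun s => by
          rw [← integral_of_le hT, integral_comp_sub_left, sub_zero,
            ← integral_interval_sub_left (hr_int 0 s) (hr_int 0 (s - T))]
          have h := hR_odd (T - s)
          rw [neg_sub] at h
          simp only [hR] at h ⊢
          rw [h, sub_neg_eq_add]
        simp only [hinner] at hsq
        rw [← integral_of_le hT, intervalIntegral.integral_add (hR_cont.intervalIntegrable _ _)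
          ((by fun_prop : Continuous fun s => R (T - s)).intervalIntegrable _ _),
          integral_comp_sub_left, sub_self, sub_zero] at hsq
        linarith
      · exact Integrable.of_bound
          (hr.comp (measurable_fst.sub measurable_snd)).aestronglyMeasurable (B * B)
          (.of_forall fun p => hr_bound _)
    · refine Integrable.of_bound (Measurable.aestronglyMeasurable ?_) (B * B)
        (.of_forall fun p => hprod _ _ _)
      exact (hg.comp ((measurable_fst.comp measurable_snd).prodMk measurable_fst)).mul
        (hg.comp ((measurable_snd.comp measurable_snd).prodMk measurable_fst))
  have hlinear : ∀ T, τ ≤ T → 0 ≤ (∫ s in (0 : ℝ)..τ, R s) + (T - τ) * R τ := fun T hT => by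
    have h := hvariance T (hτ.le.trans hT)
    have htail : ∫ s in τ..T, R s = (T - τ) * R τ := by
      rw [integral_congr (g := fun _ => R τ)]
      · simp
      · intro y hy
        rw [Set.uIcc_of_le hT] at hy
        exact hR_const y hy.1
    rwa [← integral_add_adjacent_intervals (hR_cont.intervalIntegrable 0 τ)
      (hR_cont.intervalIntegrable τ T), htail] at h
  change 0 ≤ R τ
  by_contra! hneg
  set A := ∫ s in (0 : ℝ)..τ, R s
  have hA : 0 ≤ A := by simpa using hlinear τ le_rfl
  have h := hlinear (τ + (A + 1) / (-R τ)) (by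
    have : 0 ≤ (A + 1) / (-R τ) := div_nonneg (by linarith) (by linarith)
    linarith)
  have hcancel : (A + 1) / (-R τ) * R τ = -(A + 1) := by field_simp [hneg.ne]
  rw [add_sub_cancel_left, hcancel] at h
  linarith

theorem continuous_proj (d : ℕ) : Continuous (proj d) :=
  continuous_pi fun i => (AddCircle.continuous_mk' _).comp (continuous_apply i)

theorem proj_sub (d : ℕ) (y z : Fin d → ℝ) : proj d (y - z) = proj d y - proj d z := by
  ext i
  simp [proj]

/-- under the hypotheses (H1) centering, (H2) decorrelation beyond the
autocorrelation time `τ`, and (H3) space–time homogeneity with bounded autocorrelation matrix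
`ℛ_τ`, the (symmetric part of the) diffusion matrix `𝒟_τ(t,v) = ∫_0^τ ℛ_τ(t,t,σ,σv) dσ` is
positive semidefinite: `Xᵀ 𝒟_τ(t,v) X ≥ 0` for all `X ∈ ℝ^d`. -/
theorem stmt9 (d : ℕ) (hd : 1 ≤ d) (τ : ℝ) (hτ : 0 < τ)
    (Ω : Type*) [MeasureSpace Ω] [IsProbabilityMeasure (ℙ : Measure Ω)]
    (E : ℝ → ℝ → Torus d → Ω → Vel d)
    (hmeas : Measurable fun p : (ℝ × ℝ × Torus d) × Ω => E p.1.1 p.1.2.1 p.1.2.2 p.2)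
    (hbdd : ∃ B : ℝ, ∀ t τ' x ω, ‖E t τ' x ω‖ ≤ B)
    -- (H1): the field is centered
    (hH1 : ∀ t τ' x, (∫ ω, E t τ' x ω) = 0)
    -- (H2): decorrelation for time lags `≥ τ`
    (hH2 : ∀ t τ' x s σ y, τ ≤ |τ' - σ| →
      IndepFun (fun ω => E t τ' x ω) (fun ω => E s σ y ω) ℙ)
    -- (H3): space–time homogeneity, with autocorrelation matrix `ℛ_τ`
    (ℛ : ℝ → ℝ → ℝ → Torus d → Fin d → Fin d → ℝ)
    (hH3 : ∀ t τ' x s σ y i j,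
      (∫ ω, E t τ' x ω i * E s σ y ω j) = ℛ t s (τ' - σ) (x - y) i j)
    (hℛbdd : ∃ B' : ℝ, ∀ t σ x i j, |ℛ t t σ x i j| ≤ B') :
    ∀ t ≥ (0 : ℝ), ∀ v : Vel d, ∀ X : Fin d → ℝ,
      0 ≤ ∑ i, ∑ j, X i * X j *
        ∫ σ in (0 : ℝ)..τ, ℛ t t σ (proj d fun l => σ * v l) i j := by
  intro t _ v X
  obtain ⟨B, hB⟩ := hbdd
  obtain ⟨B', hB'⟩ := hℛbdd
  set γ : ℝ → Torus d := fun σ => proj d fun l => σ * v l with hγ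
  have hγ_meas : Measurable γ :=
    ((continuous_proj d).comp
      (by fun_prop : Continuous fun (σ : ℝ) (l : Fin d) => σ * v l)).measurable
  have hγ_sub : ∀ s u, γ s - γ u = γ (s - u) := fun s u => by
    simp only [hγ, ← proj_sub]
    congr 1
    ext l
    simp [sub_mul]
  have hE : Measurable fun p : ℝ × Ω => E t p.1 (γ p.1) p.2 :=
    hmeas.comp ((measurable_const.prodMk
      (measurable_fst.prodMk (hγ_meas.comp measurable_fst))).prodMk measurable_snd)
  have hE_at : ∀ s, Measurable (E t s (γ s)) := fun s => hE.comp measurable_prodMk_left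
  have hE_apply : ∀ i, Measurable fun p : ℝ × Ω => E t p.1 (γ p.1) p.2 i := fun i =>
    (EuclideanSpace.proj (𝕜 := ℝ) i).continuous.measurable.comp hE
  have hE_apply_at : ∀ s i, Measurable fun ω => E t s (γ s) ω i := fun s i =>
    (hE_apply i).comp measurable_prodMk_left
  have hE_bound : ∀ s ω i, ‖E t s (γ s) ω i‖ ≤ B := fun s ω i =>
    (PiLp.norm_apply_le _ i).trans (hB _ _ _ _)
  have hcorr : ∀ s u i j,
      ∫ ω, E t s (γ s) ω i * E t u (γ u) ω j = ℛ t t (s - u) (γ (s - u)) i j := fun s u i j => by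
    rw [hH3, hγ_sub]
  have hprod_int : ∀ s u i j,
      Integrable (fun ω => E t s (γ s) ω i * E t u (γ u) ω j) := fun s u i j => by
    refine Integrable.of_bound
      ((hE_apply_at s i).mul (hE_apply_at u j)).aestronglyMeasurable (B * B)
      (.of_forall fun ω => ?_)
    rw [norm_mul]
    exact mul_le_mul (hE_bound s ω i) (hE_bound u ω j) (norm_nonneg _)
      ((norm_nonneg _).trans (hE_bound s ω i))
  have hℛ_meas : ∀ i j, Measurable fun σ => ℛ t t σ (γ σ) i j := fun i j => by
    have h : (fun σ => ℛ t t σ (γ σ) i j) =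
        fun σ => ∫ ω, E t σ (γ σ) ω i * E t 0 (γ 0) ω j := by
      funext σ
      rw [hcorr, sub_zero]
    rw [h]
    exact (StronglyMeasurable.integral_prod_right'
      (f := fun p : ℝ × Ω => E t p.1 (γ p.1) p.2 i * E t 0 (γ 0) p.2 j)
      ((hE_apply i).mul ((hE_apply_at 0 j).comp measurable_snd)).stronglyMeasurable).measurable
  have hℛ_int : ∀ i j, IntervalIntegrable (fun σ => ℛ t t σ (γ σ) i j) volume 0 τ := fun i j =>
    (intervalIntegrable_const (c := B')).mono_fun (hℛ_meas i j).aestronglyMeasurable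
      (.of_forall fun σ => (hB' t σ (γ σ) i j).trans (le_abs_self _))
  set r : ℝ → ℝ := fun σ => ∑ i, ∑ j, X i * X j * ℛ t t σ (γ σ) i j with hr
  have hsum : ∑ i, ∑ j, X i * X j * ∫ σ in (0 : ℝ)..τ, ℛ t t σ (γ σ) i j =
      ∫ σ in (0 : ℝ)..τ, r σ := by
    simp only [hr]
    have hrow_int : ∀ i, IntervalIntegrable
        (fun σ => ∑ j, X i * X j * ℛ t t σ (γ σ) i j) volume 0 τ := fun i => by
      simpa only [Finset.sum_fn] using
        IntervalIntegrable.sum _ fun j _ => (hℛ_int i j).const_mul (X i * X j)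
    rw [intervalIntegral.integral_finsetSum fun i _ => hrow_int i]
    refine Finset.sum_congr rfl fun i _ => ?_
    rw [intervalIntegral.integral_finsetSum fun j _ => (hℛ_int i j).const_mul _]
    simp only [intervalIntegral.integral_const_mul]
  rw [hsum]
  set L : Vel d →L[ℝ] ℝ := innerSL ℝ (WithLp.toLp 2 X) with hL
  have hL_apply : ∀ y, L y = ∑ i, X i * y i := fun y => by
    simp [hL, PiLp.inner_apply, mul_comm]
  have hL_corr : ∀ s u, ∫ ω, L (E t s (γ s) ω) * L (E t u (γ u) ω) = r (s - u) := fun s u => by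
    simp only [hL_apply, Finset.sum_mul_sum, hr, mul_mul_mul_comm (X _)]
    rw [MeasureTheory.integral_finsetSum _ fun i _ =>
      integrable_finsetSum _ fun j _ => (hprod_int s u i j).const_mul _]
    refine Finset.sum_congr rfl fun i _ => ?_
    rw [MeasureTheory.integral_finsetSum _ fun j _ => (hprod_int s u i j).const_mul _]
    simp only [MeasureTheory.integral_const_mul, hcorr]
  refine integral_autocorrelation_nonneg (ℙ : Measure Ω) (g := fun s ω => L (E t s (γ s) ω))
    (B := ‖L‖ * B) (L.continuous.measurable.comp hE) (fun s ω => ?_)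
    (Finset.measurable_fun_sum _ fun i _ => Finset.measurable_fun_sum _ fun j _ =>
      (hℛ_meas i j).const_mul _) hL_corr hτ fun σ hσ => ?_
  · exact (L.le_opNorm _).trans (mul_le_mul_of_nonneg_left (hB _ _ _ _) (norm_nonneg _))
  · have hind : IndepFun (fun ω => L (E t σ (γ σ) ω)) (fun ω => L (E t 0 (γ 0) ω)) ℙ :=
      (hH2 t σ (γ σ) t 0 (γ 0) (by simpa using hσ.trans (le_abs_self σ))).comp
        L.continuous.measurable L.continuous.measurable
    have hmean : ∫ ω, L (E t 0 (γ 0) ω) = 0 := by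
      rw [L.integral_comp_comm (Integrable.of_bound (hE_at 0).aestronglyMeasurable B
        (.of_forall fun ω => hB _ _ _ _)), hH1, map_zero]
    have h := hL_corr σ 0
    rw [hind.integral_fun_mul_eq_mul_integral
      (L.continuous.measurable.comp (hE_at σ)).aestronglyMeasurable
      (L.continuous.measurable.comp (hE_at 0)).aestronglyMeasurable, hmean, mul_zero,
      sub_zero] at h
    exact h.symm
end
end

section
/- For every g ∈ L^1(ℝ), one has ∫_{−∞}^{+∞} g(s) ds = lim_{R→+∞} (1/(2R)) ∫_{−R}^{R} ∫_{−R}^{R} g(s−t) ds dt. -/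
open MeasureTheory Filter Topology

/-- The averaged double integral, rescaled by `t = R u` to the fixed interval `[-1, 1]`. -/
lemma average_integral_eq_rescaled (g : ℝ → ℝ) {R : ℝ} (hR : R ≠ 0) :
    (1 / (2 * R)) * ∫ t in (-R)..R, ∫ s in (-R)..R, g (s - t) =
      (1 / 2) * ∫ u in (-1 : ℝ)..1, ∫ s in (-R - R * u)..(R - R * u), g s := by
  simp_rw [intervalIntegral.integral_comp_sub_right g]
  rw [intervalIntegral.integral_comp_mul_left
    (fun t => ∫ s in (-R - t)..(R - t), g s) hR, smul_eq_mul, mul_neg, mul_one]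
  field_simp

/-- The integral of an integrable function over an interval is bounded by its `L¹` norm. -/
lemma norm_intervalIntegral_le_integral_norm {g : ℝ → ℝ} (hg : Integrable g) (a b : ℝ) :
    ‖∫ s in a..b, g s‖ ≤ ∫ s, ‖g s‖ :=
  intervalIntegral.norm_integral_le_integral_norm_uIoc.trans
    (setIntegral_le_integral hg.norm (.of_forall fun _ => norm_nonneg _))

/-- The integral of an integrable function over an interval is continuous in its endpoints. -/
lemma continuous_intervalIntegral_endpoints {g : ℝ → ℝ} (hg : Integrable g) {a b : ℝ → ℝ}
    (ha : Continuous a) (hb : Continuous b) : Continuous fun u => ∫ s in (a u)..(b u), g s := by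
  have hi : ∀ x y : ℝ, IntervalIntegrable g volume x y := fun _ _ => hg.intervalIntegrable
  have hc := intervalIntegral.continuous_primitive hi 0
  simp_rw [fun u => (intervalIntegral.integral_interval_sub_left (hi 0 (b u)) (hi 0 (a u))).symm]
  exact (hc.comp hb).sub (hc.comp ha)

/-- for every `g ∈ L¹(ℝ)`,
`∫_{-∞}^{∞} g(s) ds = lim_{R→∞} (1/(2R)) ∫_{-R}^{R} ∫_{-R}^{R} g(s-t) ds dt`. -/
theorem stmt10 (g : ℝ → ℝ) (hg : Integrable g) :
    Tendsto (fun R : ℝ => (1 / (2 * R)) * ∫ t in (-R)..R, ∫ s in (-R)..R, g (s - t))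
      atTop (𝓝 (∫ s, g s)) := by
  have hlim : Tendsto
      (fun R : ℝ => ∫ u in (-1 : ℝ)..1, ∫ s in (-R - R * u)..(R - R * u), g s)
      atTop (𝓝 (∫ _ in (-1 : ℝ)..1, ∫ s, g s)) := by
    refine intervalIntegral.tendsto_integral_filter_of_dominated_convergence
      (fun _ => ∫ s, ‖g s‖) (.of_forall fun R => ?_)
      (.of_forall fun R => .of_forall fun u _ => norm_intervalIntegral_le_integral_norm hg _ _)
      intervalIntegrable_const ?_
    · exact (continuous_intervalIntegral_endpoints hg (by fun_prop)
        (by fun_prop)).aestronglyMeasurable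
    · filter_upwards [Measure.ae_ne volume (1 : ℝ)] with u hu hmem
      rw [Set.uIoc_of_le (by norm_num)] at hmem
      have hu1 : u < 1 := lt_of_le_of_ne hmem.2 hu
      refine intervalIntegral_tendsto_integral hg ?_ ?_
      · have : Tendsto (fun R : ℝ => R * (-1 - u)) atTop atBot :=
          tendsto_id.atTop_mul_const_of_neg (by linarith [hmem.1])
        exact this.congr fun R => by ring
      · have : Tendsto (fun R : ℝ => R * (1 - u)) atTop atTop :=
          tendsto_id.atTop_mul_const (by linarith)
        exact this.congr fun R => by ring
  have hmul := hlim.const_mul (1 / 2)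
  have hval : (1 / 2) * ∫ _ in (-1 : ℝ)..1, ∫ s, g s = ∫ s, g s := by
    rw [intervalIntegral.integral_const, smul_eq_mul]
    ring
  rw [hval] at hmul
  refine hmul.congr' ?_
  filter_upwards [eventually_ne_atTop 0] with R hR
  exact (average_integral_eq_rescaled g hR).symm
end

section
/- Let d ≥ 1 and 𝜏 > 0. Let ω : ℤ^d → ℝ satisfy ω(−k) = −ω(k), and let Ê_0 : ℝ^+ × ℤ^d → ℝ^d satisfy Ê_0(t,−k) = Ê_0(t,k) and sup_{t≥0} Σ_k (|k| |Ê_0(t,k)|)² < ∞. Let Λ(s) := max(0, 1−|s|) be the triangular function. Define the matrix-valued function ℛ_𝜏^0(t,σ,x) := Σ_{k∈ℤ^d} Ê_0(t,k) ⊗ Ê_0(t,k) Λ(σ/𝜏) e^{−i(ω(k)σ − k·x)}. Then ℛ_𝜏^0 is real-valued, satisfies ℛ_𝜏^0(t,σ,x) = ℛ_𝜏^0(t,−σ,−x)^T, is 2π-periodic in each component of x, vanishes for |σ| ≥ 𝜏, and its associated diffusion matrix satisfies the identity ∫_0^𝜏 ℛ_𝜏^0(t,σ,σv) dσ = (𝜏/2)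 Σ_{k∈ℤ^d} [sin((𝜏/2)(ω(k) − k·v)) / ((𝜏/2)(ω(k) − k·v))]² Ê_0(t,k) ⊗ Ê_0(t,k) for every t ≥ 0 and v ∈ ℝ^d (with the convention sin(0)/0 = 1). -/
open MeasureTheory Real Filter Topology Complex intervalIntegral

noncomputable section

/-- Euclidean norm `|k|` of a Fourier mode. -/
def knorm (d : ℕ) (k : Fin d → ℤ) : ℝ := Real.sqrt (∑ i, ((k i : ℝ)) ^ 2)

/-- The triangular function `Λ(s) = max(0, 1-|s|)`. -/
def triang (s : ℝ) : ℝ := max 0 (1 - |s|)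

/-- The squared sinc `(sin x / x)²`, with the convention `sinc(0) = 1`. -/
def sincSq (x : ℝ) : ℝ := if x = 0 then 1 else (Real.sin x / x) ^ 2

/-- The autocorrelation matrix
`ℛ⁰_τ(t,σ,x) = Σ_k Ê₀(t,k) ⊗ Ê₀(t,k) Λ(σ/τ) e^{−i(ω(k)σ − k·x)}`. -/
def Rmat (d : ℕ) (τ : ℝ) (ω : (Fin d → ℤ) → ℝ) (E0 : ℝ → (Fin d → ℤ) → Vel d)
    (t σ : ℝ) (y : Fin d → ℝ) (i j : Fin d) : ℂ :=
  ∑' k : Fin d → ℤ,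
    ((E0 t k i * E0 t k j * triang (σ / τ) : ℝ) : ℂ) *
      Complex.exp (-Complex.I * (((ω k * σ - ∑ l, (k l : ℝ) * y l : ℝ)) : ℂ))

/-- A nonzero Fourier mode has norm at least one. -/
lemma one_le_knorm {d : ℕ} {k : Fin d → ℤ} (hk : k ≠ 0) : 1 ≤ knorm d k := by
  obtain ⟨i, hi⟩ := Function.ne_iff.1 hk
  have h1 : (1 : ℝ) ≤ (k i : ℝ) ^ 2 := by
    have : (1 : ℤ) ≤ k i ^ 2 := Int.add_one_le_iff.2 (sq_pos_of_ne_zero hi)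
    exact_mod_cast this
  refine Real.one_le_sqrt.2 (h1.trans ?_)
  exact Finset.single_le_sum (f := fun i => ((k i : ℝ)) ^ 2) (fun _ _ => sq_nonneg _)
    (Finset.mem_univ i)

lemma summable_norm_sq_of_knorm {d : ℕ} {E : (Fin d → ℤ) → Vel d}
    (h : Summable fun k => (knorm d k * ‖E k‖) ^ 2) : Summable fun k => ‖E k‖ ^ 2 := by
  refine h.of_norm_bounded_eventually ?_
  filter_upwards [(Set.finite_singleton (0 : Fin d → ℤ)).compl_mem_cofinite] with k hk
  rw [Real.norm_of_nonneg (by positivity)]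
  gcongr
  exact le_mul_of_one_le_left (norm_nonneg _) (one_le_knorm hk)

lemma abs_coord_mul_coord_le {d : ℕ} (u : Vel d) (i j : Fin d) : |u i * u j| ≤ ‖u‖ ^ 2 := by
  rw [abs_mul, sq]
  exact mul_le_mul (PiLp.norm_apply_le u i) (PiLp.norm_apply_le u j) (abs_nonneg _)
    (norm_nonneg _)

lemma continuous_triang : Continuous triang := by
  unfold triang
  fun_prop

lemma triang_neg (s : ℝ) : triang (-s) = triang s := by simp [triang]

lemma triang_nonneg (s : ℝ) : 0 ≤ triang s := le_max_left _ _

lemma triang_le_one (s : ℝ) : triang s ≤ 1 :=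
  max_le zero_le_one (by linarith [abs_nonneg s])

lemma triang_eq_zero {s : ℝ} (hs : 1 ≤ |s|) : triang s = 0 := max_eq_left (by linarith)

lemma triang_div_eq {τ σ : ℝ} (hτ : 0 < τ) (h0 : 0 ≤ σ) (h1 : σ ≤ τ) :
    triang (σ / τ) = 1 - σ / τ := by
  rw [triang, abs_of_nonneg (by positivity), max_eq_right]
  rw [sub_nonneg]
  exact (div_le_one hτ).2 h1

/-- The cosine transform of the triangular function is the Fejér kernel. -/
lemma integral_triang_mul_cos {τ : ℝ} (hτ : 0 < τ) (a : ℝ) :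
    ∫ σ in (0 : ℝ)..τ, triang (σ / τ) * Real.cos (a * σ) = τ / 2 * sincSq (τ / 2 * a) := by
  have hcongr : ∫ σ in (0 : ℝ)..τ, triang (σ / τ) * Real.cos (a * σ)
      = ∫ σ in (0 : ℝ)..τ, (1 - σ / τ) * Real.cos (a * σ) := by
    refine intervalIntegral.integral_congr fun σ hσ => ?_
    rw [Set.uIcc_of_le hτ.le] at hσ
    simp only [triang_div_eq hτ hσ.1 hσ.2]
  rw [hcongr]
  by_cases ha : a = 0
  · have hderiv : ∀ σ ∈ Set.uIcc 0 τ,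
        HasDerivAt (fun s : ℝ => s - s ^ 2 / (2 * τ)) ((1 - σ / τ) * Real.cos (a * σ)) σ := by
      intro σ _
      refine ((hasDerivAt_id σ).sub ((hasDerivAt_pow 2 σ).div_const (2 * τ))).congr_deriv ?_
      simp only [ha, zero_mul, Real.cos_zero]
      field_simp
      norm_num
      ring
    rw [intervalIntegral.integral_eq_sub_of_hasDerivAt hderiv
      (Continuous.intervalIntegrable (by fun_prop) _ _)]
    simp only [ha, sincSq, mul_zero, if_true]
    field_simp
    ring
  · have hderiv : ∀ σ ∈ Set.uIcc 0 τ,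
        HasDerivAt (fun s : ℝ => (1 - s / τ) * (Real.sin (a * s) / a)
          - Real.cos (a * s) / (a ^ 2 * τ)) ((1 - σ / τ) * Real.cos (a * σ)) σ := by
      intro σ _
      have hlin : HasDerivAt (fun s : ℝ => a * s) (a * 1) σ := (hasDerivAt_id σ).const_mul a
      have hone : HasDerivAt (fun s : ℝ => 1 - s / τ) (-(1 / τ)) σ :=
        ((hasDerivAt_id σ).div_const τ).const_sub 1
      refine ((hone.mul (hlin.sin.div_const a)).sub
        (hlin.cos.div_const (a ^ 2 * τ))).congr_deriv ?_
      field_simp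
      ring
    rw [intervalIntegral.integral_eq_sub_of_hasDerivAt hderiv
      (Continuous.intervalIntegrable (by fun_prop) _ _)]
    have hcos : Real.cos (a * τ) = 1 - 2 * Real.sin (τ / 2 * a) ^ 2 := by
      rw [show a * τ = 2 * (τ / 2 * a) by ring, Real.cos_two_mul, Real.cos_sq']
      ring
    have hne : τ / 2 * a ≠ 0 := by positivity
    simp only [sincSq, if_neg hne, hcos, mul_zero, Real.sin_zero, Real.cos_zero]
    field_simp
    ring

/-- The sum of a family of complex numbers with Hermitian symmetry is real. -/
lemma tsum_im_eq_zero_of_conj {G : Type*} [InvolutiveNeg G] {f : G → ℂ}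
    (hf : ∀ k, f (-k) = (starRingEnd ℂ) (f k)) : (∑' k, f k).im = 0 := by
  rw [← Complex.conj_eq_iff_im, Complex.conj_tsum, ← (Equiv.neg G).tsum_eq f]
  exact tsum_congr fun k => (hf k).symm

lemma exp_neg_I_mul_re (θ : ℝ) : (Complex.exp (-Complex.I * (θ : ℂ))).re = Real.cos θ := by
  rw [show -Complex.I * (θ : ℂ) = ((-θ : ℝ) : ℂ) * Complex.I by push_cast; ring,
    Complex.exp_ofReal_mul_I_re, Real.cos_neg]

lemma norm_exp_neg_I_mul (θ : ℝ) : ‖Complex.exp (-Complex.I * (θ : ℂ))‖ = 1 := by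
  rw [show -Complex.I * (θ : ℂ) = ((-θ : ℝ) : ℂ) * Complex.I by push_cast; ring,
    Complex.norm_exp_ofReal_mul_I]

lemma phase_neg {d : ℕ} {ω : (Fin d → ℤ) → ℝ} (hω : ∀ k, ω (-k) = -ω k) (σ : ℝ)
    (y : Fin d → ℝ) (k : Fin d → ℤ) :
    ω (-k) * σ - ∑ l, ((-k) l : ℝ) * y l = -(ω k * σ - ∑ l, (k l : ℝ) * y l) := by
  simp only [hω, Pi.neg_apply, Int.cast_neg, neg_mul, Finset.sum_neg_distrib]
  ring

section Autocorrelation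

variable {d : ℕ} {τ : ℝ} {ω : (Fin d → ℤ) → ℝ} {E0 : ℝ → (Fin d → ℤ) → Vel d}

lemma Rmat_im (hω : ∀ k, ω (-k) = -ω k) (hE : ∀ t k, E0 t (-k) = E0 t k)
    (t σ : ℝ) (y : Fin d → ℝ) (i j : Fin d) : (Rmat d τ ω E0 t σ y i j).im = 0 := by
  refine tsum_im_eq_zero_of_conj fun k => ?_
  rw [phase_neg hω, hE, map_mul, Complex.conj_ofReal, ← Complex.exp_conj, map_mul, map_neg,
    Complex.conj_I, Complex.conj_ofReal, Complex.ofReal_neg, mul_neg, neg_mul, neg_neg, neg_neg]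

lemma Rmat_neg_neg (hω : ∀ k, ω (-k) = -ω k) (hE : ∀ t k, E0 t (-k) = E0 t k)
    (t σ : ℝ) (y : Fin d → ℝ) (i j : Fin d) :
    Rmat d τ ω E0 t σ y i j = Rmat d τ ω E0 t (-σ) (-y) j i := by
  unfold Rmat
  rw [← (Equiv.neg (Fin d → ℤ)).tsum_eq]
  refine tsum_congr fun k => ?_
  rw [Equiv.neg_apply, phase_neg hω, hE, neg_div, triang_neg, mul_comm (E0 t k i)]
  simp only [Pi.neg_apply, mul_neg, Finset.sum_neg_distrib]
  congr 5
  ring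

lemma Rmat_add_two_pi (t σ : ℝ) (y : Fin d → ℝ) (i j : Fin d) (m : Fin d → ℤ) :
    Rmat d τ ω E0 t σ (y + fun l => 2 * Real.pi * (m l : ℝ)) i j
      = Rmat d τ ω E0 t σ y i j := by
  refine tsum_congr fun k => ?_
  congr 1
  refine Complex.exp_eq_exp_iff_exists_int.2 ⟨∑ l, k l * m l, ?_⟩
  simp only [Pi.add_apply, mul_add, Finset.sum_add_distrib]
  have hsum : ∑ l, (k l : ℝ) * (2 * Real.pi * (m l : ℝ))
      = 2 * Real.pi * ∑ l, (k l : ℝ) * (m l : ℝ) := by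
    rw [Finset.mul_sum]
    exact Finset.sum_congr rfl fun l _ => by ring
  rw [hsum]
  push_cast
  ring

lemma Rmat_eq_zero (hτ : 0 < τ) {σ : ℝ} (hσ : τ ≤ |σ|) (t : ℝ) (y : Fin d → ℝ)
    (i j : Fin d) : Rmat d τ ω E0 t σ y i j = 0 := by
  have h : triang (σ / τ) = 0 := triang_eq_zero (by
    rw [abs_div, abs_of_pos hτ]
    exact (one_le_div hτ).2 hσ)
  simp [Rmat, h]

lemma norm_amplitude_mul_triang_mul_le (u : Vel d) (i j : Fin d) (s : ℝ) {E : Type*}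
    [SeminormedRing E] [NormedAlgebra ℝ E] (z : E) (hz : ‖z‖ ≤ 1) :
    ‖(u i * u j * triang s) • z‖ ≤ ‖u‖ ^ 2 := by
  rw [norm_smul, Real.norm_eq_abs, abs_mul, abs_of_nonneg (triang_nonneg s)]
  calc |u i * u j| * triang s * ‖z‖ ≤ ‖u‖ ^ 2 * 1 * 1 := by
        gcongr
        · exact triang_nonneg s
        · exact abs_coord_mul_coord_le u i j
        · exact triang_le_one s
    _ = ‖u‖ ^ 2 := by ring

/-- The autocorrelation matrix as a cosine series. -/
lemma Rmat_eq_tsum_cos (hω : ∀ k, ω (-k) = -ω k) (hE : ∀ t k, E0 t (-k) = E0 t k)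
    {t : ℝ} (hsum : Summable fun k => ‖E0 t k‖ ^ 2) (σ : ℝ) (y : Fin d → ℝ) (i j : Fin d) :
    Rmat d τ ω E0 t σ y i j = ((∑' k : Fin d → ℤ, E0 t k i * E0 t k j * triang (σ / τ) *
      Real.cos (ω k * σ - ∑ l, (k l : ℝ) * y l) : ℝ) : ℂ) := by
  refine Complex.ext ?_ (by rw [Rmat_im hω hE, Complex.ofReal_im])
  rw [Complex.ofReal_re, Rmat, Complex.re_tsum]
  · simp only [Complex.re_ofReal_mul, exp_neg_I_mul_re]
  · refine hsum.of_norm_bounded fun k => ?_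
    rw [← Complex.real_smul]
    exact norm_amplitude_mul_triang_mul_le _ i j _ _ (norm_exp_neg_I_mul _).le

lemma integral_Rmat (hτ : 0 < τ) (hω : ∀ k, ω (-k) = -ω k)
    (hE : ∀ t k, E0 t (-k) = E0 t k) {t : ℝ} (hsum : Summable fun k => ‖E0 t k‖ ^ 2)
    (v : Fin d → ℝ) (i j : Fin d) :
    (∫ σ in (0 : ℝ)..τ, Rmat d τ ω E0 t σ (fun l => σ * v l) i j)
      = ((τ / 2 * ∑' k : Fin d → ℤ,
          sincSq (τ / 2 * (ω k - ∑ l, (k l : ℝ) * v l)) * (E0 t k i * E0 t k j) : ℝ) : ℂ) := by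
  have hphase : ∀ (σ : ℝ) (k : Fin d → ℤ), ω k * σ - ∑ l, (k l : ℝ) * (σ * v l)
      = (ω k - ∑ l, (k l : ℝ) * v l) * σ := by
    intro σ k
    rw [sub_mul, Finset.sum_mul]
    congr 1
    exact Finset.sum_congr rfl fun l _ => by ring
  simp only [Rmat_eq_tsum_cos hω hE hsum, hphase]
  rw [intervalIntegral.integral_ofReal]
  congr 1
  have hbound : ∀ (k : Fin d → ℤ) (σ : ℝ), ‖E0 t k i * E0 t k j * triang (σ / τ) *
      Real.cos ((ω k - ∑ l, (k l : ℝ) * v l) * σ)‖ ≤ ‖E0 t k‖ ^ 2 := fun k σ =>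
    norm_amplitude_mul_triang_mul_le (E0 t k) i j _ _ (Real.abs_cos_le_one _)
  have hcont := continuous_triang
  have hint := intervalIntegral.hasSum_integral_of_dominated_convergence (μ := volume)
    (a := 0) (b := τ)
    (F := fun k σ => E0 t k i * E0 t k j * triang (σ / τ) *
      Real.cos ((ω k - ∑ l, (k l : ℝ) * v l) * σ))
    (fun k _ => ‖E0 t k‖ ^ 2)
    (fun k => Continuous.aestronglyMeasurable (by fun_prop))
    (fun k => Filter.Eventually.of_forall fun σ _ => hbound k σ)
    (Filter.Eventually.of_forall fun _ _ => hsum)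
    intervalIntegrable_const
    (Filter.Eventually.of_forall fun σ _ => (hsum.of_norm_bounded fun k => hbound k σ).hasSum)
  rw [← hint.tsum_eq, ← tsum_mul_left]
  refine tsum_congr fun k => ?_
  simp only [mul_assoc (E0 t k i * E0 t k j)]
  rw [intervalIntegral.integral_const_mul, integral_triang_mul_cos hτ]
  ring

end Autocorrelation

/-- the autocorrelation matrix `ℛ⁰_τ` built from an odd dispersion relation
`ω`, even real amplitudes `Ê₀`, and the triangular time-autocorrelation `Λ(σ/τ)` is real,
satisfies `ℛ⁰(t,σ,x) = ℛ⁰(t,−σ,−x)^T`, is `2π`-periodic in `x`, vanishes for `|σ| ≥ τ`, and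
its associated diffusion matrix is the squared-sinc (Fejér) resonance broadening
`∫_0^τ ℛ⁰(t,σ,σv) dσ = (τ/2) Σ_k sinc²((τ/2)(ω(k)−k·v)) Ê₀(t,k) ⊗ Ê₀(t,k)`. -/
theorem stmt11 (d : ℕ) (hd : 1 ≤ d) (τ : ℝ) (hτ : 0 < τ)
    (ω : (Fin d → ℤ) → ℝ) (hω : ∀ k, ω (-k) = -ω k)
    (E0 : ℝ → (Fin d → ℤ) → Vel d) (hE0even : ∀ t k, E0 t (-k) = E0 t k)
    (hE0sum : ∀ t : ℝ, Summable fun k : Fin d → ℤ => (knorm d k * ‖E0 t k‖) ^ 2)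
    (hE0bdd : ∃ C : ℝ, ∀ t : ℝ, (∑' k : Fin d → ℤ, (knorm d k * ‖E0 t k‖) ^ 2) ≤ C) :
    ∀ (t σ : ℝ) (y : Fin d → ℝ) (i j : Fin d),
      -- `ℛ⁰` is real-valued
      (Rmat d τ ω E0 t σ y i j).im = 0 ∧
      -- `ℛ⁰(t,σ,x) = ℛ⁰(t,−σ,−x)^T`
      Rmat d τ ω E0 t σ y i j = Rmat d τ ω E0 t (-σ) (-y) j i ∧
      -- `2π`-periodicity in each coordinate of `x`
      (∀ m : Fin d → ℤ,
        Rmat d τ ω E0 t σ (y + fun l => 2 * Real.pi * (m l : ℝ)) i j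
          = Rmat d τ ω E0 t σ y i j) ∧
      -- support in `|σ| < τ`
      (|σ| ≥ τ → Rmat d τ ω E0 t σ y i j = 0) ∧
      -- the diffusion matrix identity
      (∀ v : Fin d → ℝ,
        (∫ σ' in (0 : ℝ)..τ, Rmat d τ ω E0 t σ' (fun l => σ' * v l) i j)
          = ((τ / 2 * ∑' k : Fin d → ℤ,
              sincSq (τ / 2 * (ω k - ∑ l, (k l : ℝ) * v l)) * (E0 t k i * E0 t k j) : ℝ) : ℂ)) := by
  intro t σ y i j
  exact ⟨Rmat_im hω hE0even t σ y i j, Rmat_neg_neg hω hE0even t σ y i j,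
    Rmat_add_two_pi t σ y i j, fun h => Rmat_eq_zero hτ h t y i j,
    fun v => integral_Rmat hτ hω hE0even (summable_norm_sq_of_knorm (hE0sum t)) v i j⟩
end
end
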